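/- arXiv:2101.02990 — 4 statements merged into one kernel-verified Lean document; each statement's English description precedes it below -/
import Mathlib

section
/- Let λ be a frequency, let (a_n) be complex coefficients, and suppose the λ-Dirichlet series D = ∑_{n≥1} a_n e^{−λ_n s} converges for all s with Re s > σ₀ and that f is a bounded holomorphic function on C_0 = {Re s > 0} satisfying f(s) = ∑_{n≥1} a_n e^{−λ_n s} whenever Re s > σ₀. Let ψ ∈ L¹(ℝ) be such that its Fourier transform ψ̂ has compact support. Then for every s ∈ ℂ with Re s > 0, the sum ∑_{n≥1} a_n ψ̂(λ_n) e^{−λ_n s} (which has only finitely many nonzero terms, since ψ̂ has compact support and λ_n → ∞) equals ∫_ℝ f(s + it) ψ(t) dt. -/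
open Filter MeasureTheory

/-- The Fourier transform `ψ̂(x) = ∫ ψ(t) e^{−ixt} dt` of an integrable function. -/
noncomputable def fourierT (ψ : ℝ → ℂ) (x : ℝ) : ℂ :=
  ∫ t : ℝ, ψ t * Complex.exp (-(x * t) * Complex.I)


lemma sk_sinc_int (ε t : ℝ) :
    ∫ y in (-ε)..ε, Complex.exp ((y * t : ℝ) * Complex.I) = 2 * ε * (Real.sinc (ε * t) : ℝ) := by
  by_cases ht : t = 0
  · simp [ht]; ring
  · have h := intervalIntegral.integral_comp_mul_right (a := -ε) (b := ε)
      (fun u : ℝ => Complex.exp ((u : ℂ) * Complex.I)) ht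
    rw [h, neg_mul, integral_exp_mul_I_eq_sinc]
    have : (t : ℂ) ≠ 0 := by exact_mod_cast ht
    rw [Complex.real_smul]
    push_cast
    field_simp

lemma sk_fourier_vanish (ψ : ℝ → ℂ) (hψ : Integrable ψ) (R ε : ℝ) (hε : 0 < ε)
    (hR : ∀ x, R < x → fourierT ψ x = 0) (x : ℝ) (hx : R + ε < x) :
    fourierT (fun t => ψ t * (Real.sinc (ε * t) : ℝ)) x = 0 := by
  have key : (2 * ε : ℂ) * fourierT (fun t => ψ t * (Real.sinc (ε * t) : ℝ)) x
      = ∫ y in (-ε)..ε, fourierT ψ (x - y) := by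
    unfold fourierT
    rw [← integral_const_mul, intervalIntegral.integral_of_le (by linarith),
      integral_integral_swap]
    · congr 1
      ext t
      rw [← intervalIntegral.integral_of_le (by linarith)]
      have : ∀ y : ℝ, ψ t * Complex.exp (-((x - y : ℝ) * t) * Complex.I)
          = (ψ t * Complex.exp (-(x * t) * Complex.I)) * Complex.exp ((y * t : ℝ) * Complex.I) := by
        intro y
        rw [mul_assoc, ← Complex.exp_add]
        push_cast
        ring_nf
      simp_rw [this]
      rw [intervalIntegral.integral_const_mul, sk_sinc_int]
      ring
    · have h1 : Integrable (fun z : ℝ × ℝ => (1 : ℂ) * ψ z.2)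
          ((volume.restrict (Set.Ioc (-ε) ε)).prod volume) :=
        Integrable.mul_prod (f := fun _ : ℝ => (1 : ℂ)) (integrable_const _) hψ
      have h2 := h1.mul_bdd (c := 1)
        (g := fun z : ℝ × ℝ => Complex.exp (-((x - z.1 : ℝ) * z.2) * Complex.I))
        (by apply Continuous.aestronglyMeasurable; fun_prop)
        (by
          refine Eventually.of_forall fun z => ?_
          have := Complex.norm_exp_ofReal_mul_I (-((x - z.1) * z.2))
          push_cast at this ⊢
          exact this.le)
      simpa [Function.uncurry_def] using h2
  have h0 : ∫ y in (-ε)..ε, fourierT ψ (x - y) = 0 := by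
    rw [intervalIntegral.integral_congr (g := fun _ => (0 : ℂ))]
    · simp
    · intro y hy
      rw [Set.uIcc_of_le (by linarith)] at hy
      exact hR _ (by linarith [hy.2])
  rw [h0] at key
  have : (ε : ℂ) ≠ 0 := by exact_mod_cast hε.ne'
  simpa [this] using key

lemma sk_exp_diff (w : ℂ) (hw : 0 < w.re) (a b : ℝ) (hab : a ≤ b) :
    ‖Complex.exp (-(a : ℂ) * w) - Complex.exp (-(b : ℂ) * w)‖
      ≤ ‖w‖ / w.re * (Real.exp (-a * w.re) - Real.exp (-b * w.re)) := by
  have hw0 : w ≠ 0 := by rintro rfl; simp at hw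
  have h1 : ∫ u in a..b, Complex.exp (-w * u)
      = (Complex.exp (-(a : ℂ) * w) - Complex.exp (-(b : ℂ) * w)) / w := by
    rw [integral_exp_mul_complex (neg_ne_zero.2 hw0)]
    rw [mul_comm (-w) b, mul_comm (-w) a]
    field_simp
    ring_nf
  have h2 : ∫ u in a..b, Real.exp (-w.re * u)
      = (Real.exp (-a * w.re) - Real.exp (-b * w.re)) / w.re := by
    have hd : ∀ u ∈ Set.uIcc a b, HasDerivAt (fun u : ℝ => -(Real.exp (-w.re * u)) / w.re)
        (Real.exp (-w.re * u)) u := by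
      intro u _
      have := (((hasDerivAt_id u).const_mul (-w.re)).exp.neg).div_const w.re
      have e : -(Real.exp (-w.re * id u) * (-w.re * 1)) / w.re = Real.exp (-w.re * u) := by
        simp only [id_eq]
        field_simp
      rw [e] at this
      exact this
    rw [intervalIntegral.integral_eq_sub_of_hasDerivAt hd
      (by apply Continuous.intervalIntegrable; fun_prop)]
    ring_nf
  have h3 : ‖∫ u in a..b, Complex.exp (-w * u)‖ ≤ ∫ u in a..b, Real.exp (-w.re * u) := by
    refine (intervalIntegral.norm_integral_le_integral_norm hab).trans (le_of_eq ?_)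
    congr 1
    ext u
    rw [Complex.norm_exp]
    simp
  rw [h1, h2, norm_div, div_le_iff₀ (norm_pos_iff.2 hw0)] at h3
  refine h3.trans (le_of_eq ?_)
  ring

lemma sk_partial_bound (l : ℕ → ℝ) (hmono : StrictMono l) (hnonneg : ∀ n, 0 ≤ l n)
    (b : ℕ → ℂ) (K : ℝ) (hK : ∀ N, ‖∑ n ∈ Finset.range N, b n‖ ≤ K)
    (w : ℂ) (hw : 0 < w.re) (N : ℕ) :
    ‖∑ n ∈ Finset.range N, b n * Complex.exp (-(l n : ℂ) * w)‖ ≤ K + K * (‖w‖ / w.re) := by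
  have hK0 : 0 ≤ K := (norm_nonneg _).trans (hK 0)
  have hT : ∀ N, ‖∑ n ∈ Finset.range N, b n * Complex.exp (-(l n : ℂ) * w)
      - (∑ n ∈ Finset.range N, b n) * Complex.exp (-(l N : ℂ) * w)‖
      ≤ K * (‖w‖ / w.re * (Real.exp (-l 0 * w.re) - Real.exp (-l N * w.re))) := by
    intro N
    induction N with
    | zero => simp
    | succ N ih =>
      have e : ∑ n ∈ Finset.range (N+1), b n * Complex.exp (-(l n : ℂ) * w)
          - (∑ n ∈ Finset.range (N+1), b n) * Complex.exp (-(l (N+1) : ℂ) * w)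
          = (∑ n ∈ Finset.range N, b n * Complex.exp (-(l n : ℂ) * w)
            - (∑ n ∈ Finset.range N, b n) * Complex.exp (-(l N : ℂ) * w))
          + (∑ n ∈ Finset.range (N+1), b n) *
            (Complex.exp (-(l N : ℂ) * w) - Complex.exp (-(l (N+1) : ℂ) * w)) := by
        rw [Finset.sum_range_succ, Finset.sum_range_succ]; ring
      rw [e]
      refine (norm_add_le _ _).trans ?_
      rw [norm_mul]
      have h1 := sk_exp_diff w hw (l N) (l (N+1)) (hmono (Nat.lt_succ_self N)).le
      have h2 := mul_le_mul (hK (N+1)) h1 (norm_nonneg _) hK0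
      calc _ ≤ _ := add_le_add ih h2
        _ = _ := by ring
  have hexp : ∀ n, Real.exp (-l n * w.re) ≤ 1 := fun n => by
    rw [Real.exp_le_one_iff]; nlinarith [hnonneg n]
  have h1 : ‖(∑ n ∈ Finset.range N, b n) * Complex.exp (-(l N : ℂ) * w)‖ ≤ K := by
    rw [norm_mul, Complex.norm_exp]
    have : (-(l N : ℂ) * w).re = -l N * w.re := by simp
    rw [this]
    calc _ ≤ K * 1 := mul_le_mul (hK N) (hexp N) (Real.exp_pos _).le hK0
      _ = K := mul_one K
  have h2 : K * (‖w‖ / w.re * (Real.exp (-l 0 * w.re) - Real.exp (-l N * w.re)))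
      ≤ K * (‖w‖ / w.re) := by
    refine mul_le_mul_of_nonneg_left ?_ hK0
    refine mul_le_of_le_one_right (by positivity) ?_
    linarith [hexp 0, Real.exp_pos (-l N * w.re)]
  have h3 := norm_sub_norm_le (∑ n ∈ Finset.range N, b n * Complex.exp (-(l n : ℂ) * w))
    ((∑ n ∈ Finset.range N, b n) * Complex.exp (-(l N : ℂ) * w))
  linarith [hT N]

lemma sk_line_cont (f : ℂ → ℂ) (hf : DifferentiableOn ℂ f {s : ℂ | 0 < s.re}) (s : ℂ)
    (hs : 0 < s.re) : Continuous fun t : ℝ => f (s + (t : ℂ) * Complex.I) := by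
  refine hf.continuousOn.comp_continuous (by fun_prop) fun t => ?_
  simpa using hs

lemma sk_diff (f : ℂ → ℂ) (hf : DifferentiableOn ℂ f {s : ℂ | 0 < s.re}) (M : ℝ)
    (hM : ∀ s : ℂ, 0 < s.re → ‖f s‖ ≤ M) (ψ : ℝ → ℂ) (hψ : Integrable ψ) :
    DifferentiableOn ℂ (fun s => ∫ t : ℝ, f (s + (t : ℂ) * Complex.I) * ψ t)
      {s : ℂ | 0 < s.re} := by
  have hopen : IsOpen {s : ℂ | 0 < s.re} := isOpen_lt continuous_const Complex.continuous_re
  intro s hs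
  have hs' : 0 < s.re := hs
  have hd : DifferentiableOn ℂ (deriv f) {s : ℂ | 0 < s.re} := hf.deriv hopen
  have hball : ∀ z ∈ Metric.ball s (s.re / 2), s.re / 2 < z.re := by
    intro z hz
    have h1 := Complex.abs_re_le_norm (z - s)
    have h2 : ‖z - s‖ < s.re / 2 := by simpa [dist_eq_norm] using hz
    have h3 := (abs_lt.1 (h1.trans_lt h2)).1
    simp at h3
    linarith
  refine (hasDerivAt_integral_of_dominated_loc_of_deriv_le (μ := volume)
    (F := fun s (t : ℝ) => f (s + (t : ℂ) * Complex.I) * ψ t)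
    (F' := fun s (t : ℝ) => deriv f (s + (t : ℂ) * Complex.I) * ψ t)
    (bound := fun t => M / (s.re / 2) * ‖ψ t‖)
    (Metric.ball_mem_nhds s (half_pos hs')) ?_ ?_ ?_ ?_ ?_ ?_).2.differentiableAt.differentiableWithinAt
  · filter_upwards [hopen.mem_nhds hs] with z hz
    exact (sk_line_cont f hf z hz).aestronglyMeasurable.mul hψ.1
  · exact hψ.bdd_mul (c := M) (sk_line_cont f hf s hs).aestronglyMeasurable
      (Eventually.of_forall fun t => hM _ (by simpa using hs'))
  · exact (sk_line_cont (deriv f) hd s hs).aestronglyMeasurable.mul hψ.1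
  · refine Eventually.of_forall fun t z hz => ?_
    rw [norm_mul]
    refine mul_le_mul_of_nonneg_right ?_ (norm_nonneg _)
    have hsub : Metric.closedBall (z + (t : ℂ) * Complex.I) (s.re / 2) ⊆ {s : ℂ | 0 < s.re} := by
      intro u hu
      have h1 := Complex.abs_re_le_norm (u - (z + (t : ℂ) * Complex.I))
      have h2 : ‖u - (z + (t : ℂ) * Complex.I)‖ ≤ s.re / 2 := by simpa [dist_eq_norm] using hu
      have h3 := (abs_le.1 (h1.trans h2)).1
      simp at h3
      have := hball z hz
      show 0 < u.re
      linarith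
    refine Complex.norm_deriv_le_of_forall_mem_sphere_norm_le (half_pos hs') ?_ ?_
    · refine (hf.mono ?_).diffContOnCl
      exact (Metric.closure_ball_subset_closedBall).trans hsub
    · intro u hu
      exact hM u (hsub (Metric.sphere_subset_closedBall hu))
  · exact hψ.norm.const_mul _
  · refine Eventually.of_forall fun t z hz => ?_
    have hz' : 0 < (z + (t : ℂ) * Complex.I).re := by
      have := hball z hz
      simp; linarith
    have h1 := (hf.differentiableAt (hopen.mem_nhds hz')).hasDerivAt
    exact (h1.comp_add_const z ((t : ℂ) * Complex.I)).mul_const (ψ t)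

lemma sk_large (l : ℕ → ℝ) (hmono : StrictMono l) (hnonneg : ∀ n, 0 ≤ l n)
    (a : ℕ → ℂ) (σ : ℝ) (hσ : 0 < σ) (f : ℂ → ℂ)
    (hconv : ∀ s : ℂ, σ ≤ s.re →
      Tendsto (fun N : ℕ => ∑ n ∈ Finset.range N, a n * Complex.exp (-(l n : ℂ) * s))
        atTop (nhds (f s)))
    (hf : DifferentiableOn ℂ f {s : ℂ | 0 < s.re})
    (M : ℝ) (hM : ∀ s : ℂ, 0 < s.re → ‖f s‖ ≤ M)
    (ψ : ℝ → ℂ) (hψ : Integrable ψ) (R : ℝ) (hR : ∀ x, R < x → fourierT ψ x = 0)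
    (N₀ : ℕ) (hN₀ : ∀ n, N₀ ≤ n → R + 1 < l n) (s : ℂ) (hs : σ < s.re) :
    ∑ n ∈ Finset.range N₀, a n * fourierT ψ (l n) * Complex.exp (-(l n : ℂ) * s)
        = ∫ t : ℝ, f (s + (t : ℂ) * Complex.I) * ψ t := by
  have hs0 : 0 < s.re := hσ.trans hs
  -- the exponential kernel has modulus one
  have hker : ∀ x t : ℝ, ‖Complex.exp (-((x : ℂ) * t) * Complex.I)‖ = 1 := by
    intro x t
    have := Complex.norm_exp_ofReal_mul_I (-(x * t))
    push_cast at this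
    exact this
  obtain ⟨K, hK⟩ : ∃ K : ℝ, ∀ N,
      ‖∑ n ∈ Finset.range N, a n * Complex.exp (-(l n : ℂ) * (σ : ℂ))‖ ≤ K := by
    obtain ⟨K, hK⟩ := (hconv (σ : ℂ) (by simp)).norm.bddAbove_range
    exact ⟨K, fun N => hK ⟨N, rfl⟩⟩
  have hK0 : 0 ≤ K := (norm_nonneg _).trans (hK 0)
  -- the identity for the regularised kernels
  have hreg : ∀ ε : ℝ, 0 < ε → ε ≤ 1 →
      ∑ n ∈ Finset.range N₀, a n * fourierT (fun t => ψ t * (Real.sinc (ε * t) : ℝ)) (l n)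
          * Complex.exp (-(l n : ℂ) * s)
        = ∫ t : ℝ, f (s + (t : ℂ) * Complex.I) * (ψ t * (Real.sinc (ε * t) : ℝ)) := by
    intro ε hε hε1
    have hmeas : AEStronglyMeasurable (fun t => ψ t * (Real.sinc (ε * t) : ℝ)) volume := by
      refine hψ.1.mul (Continuous.aestronglyMeasurable ?_)
      exact Complex.continuous_ofReal.comp (Real.continuous_sinc.comp (by fun_prop))
    have hint : Integrable (fun t => ψ t * (Real.sinc (ε * t) : ℝ)) := by
      refine hψ.mono hmeas (Eventually.of_forall fun t => ?_)
      rw [norm_mul, Complex.norm_real]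
      exact mul_le_of_le_one_right (norm_nonneg _) (Real.abs_sinc_le_one _)
    set δ := s.re - σ with hδ
    have hδ0 : 0 < δ := by rw [hδ]; linarith
    have hlim := tendsto_integral_of_dominated_convergence (μ := volume)
      (F := fun N (t : ℝ) => (∑ n ∈ Finset.range N,
        a n * Complex.exp (-(l n : ℂ) * (s + (t : ℂ) * Complex.I)))
          * (ψ t * (Real.sinc (ε * t) : ℝ)))
      (f := fun t : ℝ => f (s + (t : ℂ) * Complex.I) * (ψ t * (Real.sinc (ε * t) : ℝ)))
      (fun t => (K + K * ((‖s - σ‖ + 1 / ε) / δ)) * ‖ψ t‖)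
      (fun N => (Continuous.aestronglyMeasurable (by fun_prop)).mul hmeas)
      (hψ.norm.const_mul _)
      (fun N => Eventually.of_forall fun t => by
        have hre : (s + (t : ℂ) * Complex.I - σ).re = δ := by simp [hδ]
        have hb := sk_partial_bound l hmono hnonneg
          (fun n => a n * Complex.exp (-(l n : ℂ) * (σ : ℂ))) K hK
          (s + (t : ℂ) * Complex.I - σ) (by rw [hre]; exact hδ0) N
        have hsum : ∑ n ∈ Finset.range N, a n * Complex.exp (-(l n : ℂ) * (σ : ℂ))
              * Complex.exp (-(l n : ℂ) * (s + (t : ℂ) * Complex.I - σ))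
            = ∑ n ∈ Finset.range N,
              a n * Complex.exp (-(l n : ℂ) * (s + (t : ℂ) * Complex.I)) := by
          refine Finset.sum_congr rfl fun n _ => ?_
          rw [mul_assoc, ← Complex.exp_add]
          ring_nf
        rw [hsum, hre] at hb
        have hw : ‖s + (t : ℂ) * Complex.I - σ‖ ≤ ‖s - σ‖ + |t| := by
          have : s + (t : ℂ) * Complex.I - σ = (s - σ) + (t : ℂ) * Complex.I := by ring
          rw [this]
          refine (norm_add_le _ _).trans ?_
          simp
        have hsc : |Real.sinc (ε * t)| ≤ 1 := Real.abs_sinc_le_one _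
        have hst : |t| * |Real.sinc (ε * t)| ≤ 1 / ε := by
          by_cases ht : t = 0
          · simp [ht, hε.le]
          · have hne : ε * t ≠ 0 := mul_ne_zero hε.ne' ht
            rw [Real.sinc_of_ne_zero hne, abs_div, abs_mul, abs_of_pos hε]
            have h1 := Real.abs_sin_le_one (ε * t)
            have h2 : 0 < |t| := abs_pos.2 ht
            rw [show |t| * (|Real.sin (ε * t)| / (ε * |t|)) = |Real.sin (ε * t)| / ε by
              field_simp]
            gcongr
        have hcomb : ‖s + (t : ℂ) * Complex.I - σ‖ * |Real.sinc (ε * t)| ≤ ‖s - σ‖ + 1 / ε := by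
          calc _ ≤ (‖s - σ‖ + |t|) * |Real.sinc (ε * t)| := by gcongr
            _ = ‖s - σ‖ * |Real.sinc (ε * t)| + |t| * |Real.sinc (ε * t)| := by ring
            _ ≤ ‖s - σ‖ * 1 + 1 / ε := by gcongr
            _ = _ := by ring
        rw [norm_mul, norm_mul, Complex.norm_real, Real.norm_eq_abs]
        calc _ ≤ (K + K * (‖s + (t : ℂ) * Complex.I - σ‖ / δ))
                * (‖ψ t‖ * |Real.sinc (ε * t)|) := by gcongr
          _ = (K * |Real.sinc (ε * t)|
              + K * ((‖s + (t : ℂ) * Complex.I - σ‖ * |Real.sinc (ε * t)|) / δ)) * ‖ψ t‖ := by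
            ring
          _ ≤ (K * 1 + K * ((‖s - σ‖ + 1 / ε) / δ)) * ‖ψ t‖ := by gcongr
          _ = _ := by ring)
      (Eventually.of_forall fun t =>
        (hconv (s + (t : ℂ) * Complex.I) (by simpa using hs.le)).mul_const _)
    have hval : ∀ N, ∫ t : ℝ, (∑ n ∈ Finset.range N,
          a n * Complex.exp (-(l n : ℂ) * (s + (t : ℂ) * Complex.I)))
          * (ψ t * (Real.sinc (ε * t) : ℝ))
        = ∑ n ∈ Finset.range N, a n * fourierT (fun t => ψ t * (Real.sinc (ε * t) : ℝ)) (l n)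
          * Complex.exp (-(l n : ℂ) * s) := by
      intro N
      have e : ∀ t : ℝ, (∑ n ∈ Finset.range N,
          a n * Complex.exp (-(l n : ℂ) * (s + (t : ℂ) * Complex.I)))
          * (ψ t * (Real.sinc (ε * t) : ℝ))
          = ∑ n ∈ Finset.range N, (a n * Complex.exp (-(l n : ℂ) * s)) *
            ((ψ t * (Real.sinc (ε * t) : ℝ)) * Complex.exp (-((l n : ℂ) * t) * Complex.I)) := by
        intro t
        rw [Finset.sum_mul]
        refine Finset.sum_congr rfl fun n _ => ?_
        rw [show -(l n : ℂ) * (s + (t : ℂ) * Complex.I)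
          = -(l n : ℂ) * s + -((l n : ℂ) * t) * Complex.I by ring, Complex.exp_add]
        ring
      simp_rw [e]
      rw [integral_finsetSum]
      · refine Finset.sum_congr rfl fun n _ => ?_
        rw [integral_const_mul]
        unfold fourierT
        ring
      · intro n _
        refine Integrable.const_mul ?_ _
        exact hint.mul_bdd (c := 1) (Continuous.aestronglyMeasurable (by fun_prop))
          (Eventually.of_forall fun t => (hker _ _).le)
    simp_rw [hval] at hlim
    refine tendsto_nhds_unique (tendsto_const_nhds.congr' ?_) hlim
    filter_upwards [eventually_ge_atTop N₀] with N hN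
    refine Finset.sum_subset (Finset.range_mono hN) fun n _ hn => ?_
    have hn' : N₀ ≤ n := by simpa using hn
    rw [sk_fourier_vanish ψ hψ R ε hε hR (l n) (by linarith [hN₀ n hn'])]
    simp
  -- pass to the limit
  have hsincT : ∀ t : ℝ, Tendsto (fun k : ℕ => ((Real.sinc ((1 / ((k : ℝ) + 1)) * t) : ℝ) : ℂ))
      atTop (nhds 1) := by
    intro t
    have h1 : Tendsto (fun k : ℕ => (1 / ((k : ℝ) + 1)) * t) atTop (nhds (0 * t)) :=
      tendsto_one_div_add_atTop_nhds_zero_nat.mul_const t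
    rw [zero_mul] at h1
    have h2 := (Real.continuous_sinc.tendsto 0).comp h1
    rw [Real.sinc_zero] at h2
    exact_mod_cast (Complex.continuous_ofReal.tendsto 1).comp h2
  have hDCT : ∀ (g : ℝ → ℂ) (C : ℝ), Continuous g → (∀ t, ‖g t‖ ≤ C) →
      Tendsto (fun k : ℕ => ∫ t : ℝ, g t * (ψ t * (Real.sinc ((1 / ((k : ℝ) + 1)) * t) : ℝ)))
        atTop (nhds (∫ t : ℝ, g t * ψ t)) := by
    intro g C hg hC
    refine tendsto_integral_of_dominated_convergence (fun t => C * ‖ψ t‖) ?_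
      (hψ.norm.const_mul _) ?_ ?_
    · intro k
      refine hg.aestronglyMeasurable.mul (hψ.1.mul (Continuous.aestronglyMeasurable ?_))
      exact Complex.continuous_ofReal.comp (Real.continuous_sinc.comp (by fun_prop))
    · intro k
      refine Eventually.of_forall fun t => ?_
      rw [norm_mul, norm_mul, Complex.norm_real]
      refine mul_le_mul (hC t) ?_ (by positivity) ((norm_nonneg _).trans (hC t))
      exact mul_le_of_le_one_right (norm_nonneg _) (Real.abs_sinc_le_one _)
    · refine Eventually.of_forall fun t => ?_
      simpa using ((hsincT t).const_mul (ψ t)).const_mul (g t)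
  have hR1 := hDCT (fun t => f (s + (t : ℂ) * Complex.I)) M (sk_line_cont f hf s hs0)
    (fun t => hM _ (by simpa using hs0))
  have hF : ∀ x : ℝ, Tendsto (fun k : ℕ =>
      fourierT (fun t => ψ t * (Real.sinc ((1 / ((k : ℝ) + 1)) * t) : ℝ)) x)
      atTop (nhds (fourierT ψ x)) := by
    intro x
    have := hDCT (fun t => Complex.exp (-((x : ℂ) * t) * Complex.I)) 1 (by fun_prop)
      (fun t => (hker x t).le)
    unfold fourierT
    simp_rw [mul_comm _ (Complex.exp _)]
    exact this
  have hL1 : Tendsto (fun k : ℕ => ∑ n ∈ Finset.range N₀,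
      a n * fourierT (fun t => ψ t * (Real.sinc ((1 / ((k : ℝ) + 1)) * t) : ℝ)) (l n)
          * Complex.exp (-(l n : ℂ) * s)) atTop
      (nhds (∑ n ∈ Finset.range N₀, a n * fourierT ψ (l n) * Complex.exp (-(l n : ℂ) * s))) :=
    tendsto_finsetSum _ fun n _ => ((hF (l n)).const_mul (a n)).mul_const _
  refine tendsto_nhds_unique hL1 (hR1.congr fun k => ?_)
  refine (hreg (1 / ((k : ℝ) + 1)) (by positivity) ?_).symm
  rw [div_le_one (by positivity)]
  linarith [Nat.cast_nonneg (α := ℝ) k]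

/-- Saksman's vertical convolution formula for general Dirichlet series in
`𝒟_∞^{ext}(λ)`: if `D = ∑ aₙ e^{−λₙ s}` converges on `[Re s > σ₀]` and extends to a bounded
holomorphic function `f` on `[Re s > 0]`, and `ψ ∈ L¹(ℝ)` has compactly supported Fourier
transform, then `∑ aₙ ψ̂(λₙ) e^{−λₙ s} = ∫ f(s+it) ψ(t) dt` for all `Re s > 0`. -/
theorem saksman_formula_ext (l : ℕ → ℝ) (hmono : StrictMono l) (hnonneg : ∀ n, 0 ≤ l n)
    (htend : Tendsto l atTop atTop)
    (a : ℕ → ℂ) (σ₀ : ℝ) (f : ℂ → ℂ)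
    (hconv : ∀ s : ℂ, σ₀ < s.re →
      Tendsto (fun N : ℕ => ∑ n ∈ Finset.range N, a n * Complex.exp (-(l n : ℂ) * s))
        atTop (nhds (f s)))
    (hf : DifferentiableOn ℂ f {s : ℂ | 0 < s.re})
    (hbdd : ∃ M : ℝ, ∀ s : ℂ, 0 < s.re → ‖f s‖ ≤ M)
    (ψ : ℝ → ℂ) (hψ : Integrable ψ) (hsupp : HasCompactSupport (fourierT ψ)) :
    ∀ s : ℂ, 0 < s.re →
      ∑' n : ℕ, a n * fourierT ψ (l n) * Complex.exp (-(l n : ℂ) * s)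
        = ∫ t : ℝ, f (s + (t : ℂ) * Complex.I) * ψ t := by
  obtain ⟨M, hM⟩ := hbdd
  obtain ⟨R, hR⟩ : ∃ R : ℝ, ∀ x, R < x → fourierT ψ x = 0 := by
    obtain ⟨R, hR⟩ := hsupp.isCompact.bddAbove
    refine ⟨R, fun x hx => ?_⟩
    by_contra h
    exact absurd (hR (subset_tsupport _ h)) (not_le.2 hx)
  obtain ⟨N₀, hN₀⟩ := (eventually_atTop.1 (htend.eventually_gt_atTop (R + 1)))
  have hopen : IsOpen {s : ℂ | 0 < s.re} := isOpen_lt continuous_const Complex.continuous_re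
  have hpre : IsPreconnected {s : ℂ | 0 < s.re} :=
    (convex_halfSpace_re_gt 0).isPreconnected
  set σ : ℝ := max σ₀ 0 + 1 with hσ
  have hσ0 : 0 < σ := by have := le_max_right σ₀ 0; linarith
  have hσ1 : σ₀ < σ := by have := le_max_left σ₀ 0; linarith
  have hA := (sk_diff f hf M hM ψ hψ).analyticOnNhd hopen
  have hB : AnalyticOnNhd ℂ (fun s : ℂ => ∑ n ∈ Finset.range N₀,
      a n * fourierT ψ (l n) * Complex.exp (-(l n : ℂ) * s)) {s : ℂ | 0 < s.re} :=
    DifferentiableOn.analyticOnNhd (by fun_prop) hopen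
  have hz : ((σ + 1 : ℝ) : ℂ) ∈ {s : ℂ | 0 < s.re} := by
    show 0 < ((σ + 1 : ℝ) : ℂ).re
    rw [Complex.ofReal_re]; linarith
  have heq := hB.eqOn_of_preconnected_of_eventuallyEq hA hpre hz (by
    have ho : IsOpen {s : ℂ | σ < s.re} := isOpen_lt continuous_const Complex.continuous_re
    filter_upwards [ho.mem_nhds (show ((σ + 1 : ℝ) : ℂ) ∈ {s : ℂ | σ < s.re} by
      show σ < ((σ + 1 : ℝ) : ℂ).re
      rw [Complex.ofReal_re]; linarith)] with s hs
    exact sk_large l hmono hnonneg a σ hσ0 f (fun s hs => hconv s (hσ1.trans_le hs)) hf M hM ψ hψ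
      R hR N₀ hN₀ s hs)
  intro s hs
  rw [tsum_eq_sum (s := Finset.range N₀)]
  · exact heq hs
  · intro n hn
    have hn' : N₀ ≤ n := by simpa using hn
    rw [hR (l n) (by linarith [hN₀ n hn'])]
    simp
end

section
/- Let λ be a frequency, let (a_n) be complex coefficients, and suppose the λ-Dirichlet series D = ∑_{n≥1} a_n e^{−λ_n s} converges for all s with Re s > σ₀ and that f is a bounded holomorphic function on C_0 = {Re s > 0} satisfying f(s) = ∑_{n≥1} a_n e^{−λ_n s} whenever Re s > σ₀; set ‖f‖_∞ := sup_{Re s>0}|f(s)|. Let ψ ∈ L¹(ℝ) be such that its Fourier transform ψ̂ has compact support, and define R_ψ(D)(s) := ∑_{n≥1} a_n ψ̂(λ_n) e^{−λ_n s} (a finite sum). Then: (i) sup_{Re s>0} |R_ψ(D)(s)| ≤ ‖ψ‖_{L¹(ℝ)} · ‖f‖_∞; (ii) if moreover ∫_ℝ ψ(t) dt = 1 and ψ_N(t) := N·ψ(N t) for N ∈ ℕ, then for every ε > 0 the functions R_{ψ_N}(D) converge uniformly to f on C_ε = {Re s > ε} as N → ∞. -/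
open Filter MeasureTheory

/-- Elementary exponential increment bound. -/
theorem aux_exp_diff (w : ℂ) (hw : 0 < w.re) (x y : ℝ) (hxy : x ≤ y) :
    ‖Complex.exp (-(x : ℂ) * w) - Complex.exp (-(y : ℂ) * w)‖ ≤
      ‖w‖ / w.re * (Real.exp (-x * w.re) - Real.exp (-y * w.re)) := by
  have h1 : ∫ t in x..y, (-w) * Complex.exp (-(t : ℂ) * w) =
      Complex.exp (-(y : ℂ) * w) - Complex.exp (-(x : ℂ) * w) := by
    apply intervalIntegral.integral_eq_sub_of_hasDerivAt (f := fun t : ℝ => Complex.exp (-(t : ℂ) * w))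
    · intro t _
      have h : HasDerivAt (fun z : ℂ => Complex.exp (-z * w)) (Complex.exp (-(t:ℂ) * w) * (-1 * w)) (t : ℂ) :=
        (((hasDerivAt_id (t : ℂ)).neg.mul_const w)).cexp
      exact h.comp_ofReal.congr_deriv (by ring)
    · apply Continuous.intervalIntegrable
      fun_prop
  have h2 : ∫ t in x..y, ‖w‖ * Real.exp (-t * w.re) =
      (-(‖w‖ / w.re)) * Real.exp (-y * w.re) - (-(‖w‖ / w.re)) * Real.exp (-x * w.re) := by
    apply intervalIntegral.integral_eq_sub_of_hasDerivAt
      (f := fun t : ℝ => (-(‖w‖ / w.re)) * Real.exp (-t * w.re))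
    · intro t _
      have h := ((((hasDerivAt_id t).neg.mul_const w.re)).exp).const_mul (-(‖w‖ / w.re))
      refine h.congr_deriv ?_
      have e : (-id : ℝ → ℝ) t = -t := rfl
      rw [e]
      field_simp
    · apply Continuous.intervalIntegrable
      fun_prop
  have h3 := intervalIntegral.norm_integral_le_of_norm_le (μ := volume) (f := fun t : ℝ => (-w) * Complex.exp (-(t : ℂ) * w))
    (g := fun t => ‖w‖ * Real.exp (-t * w.re)) hxy
    (Eventually.of_forall fun t _ => by simp [Complex.norm_exp])
    (by apply Continuous.intervalIntegrable; fun_prop)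
  rw [h1, h2] at h3
  rw [norm_sub_rev]
  refine h3.trans (le_of_eq ?_)
  ring

/-- Abel summation bound. -/
theorem aux_abel (l : ℕ → ℝ) (hmono : StrictMono l) (hnonneg : ∀ n, 0 ≤ l n)
    (b : ℕ → ℂ) (B : ℝ) (hB : ∀ N, ‖∑ n ∈ Finset.range N, b n‖ ≤ B) (w : ℂ) (hw : 0 < w.re) (N : ℕ) :
    ‖∑ n ∈ Finset.range N, b n * Complex.exp (-(l n : ℂ) * w)‖ ≤ B + B * (‖w‖ / w.re) := by
  have hB0 : 0 ≤ B := (norm_nonneg _).trans (hB 0)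
  have hq : 0 ≤ ‖w‖ / w.re := by positivity
  have key : ∀ N, ‖∑ n ∈ Finset.range N, b n * Complex.exp (-(l n : ℂ) * w) -
      (∑ n ∈ Finset.range N, b n) * Complex.exp (-(l N : ℂ) * w)‖ ≤
      B * (‖w‖ / w.re * (Real.exp (-l 0 * w.re) - Real.exp (-l N * w.re))) := by
    intro N
    induction N with
    | zero => simp
    | succ N ih =>
      have e : ∑ n ∈ Finset.range (N+1), b n * Complex.exp (-(l n : ℂ) * w) -
          (∑ n ∈ Finset.range (N+1), b n) * Complex.exp (-(l (N+1) : ℂ) * w) =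
          (∑ n ∈ Finset.range N, b n * Complex.exp (-(l n : ℂ) * w) -
          (∑ n ∈ Finset.range N, b n) * Complex.exp (-(l N : ℂ) * w)) +
          (∑ n ∈ Finset.range (N+1), b n) *
            (Complex.exp (-(l N : ℂ) * w) - Complex.exp (-(l (N+1) : ℂ) * w)) := by
        simp only [Finset.sum_range_succ]
        ring
      rw [e]
      have h2 := aux_exp_diff w hw (l N) (l (N+1)) (hmono (Nat.lt_succ_self N)).le
      have h3 := mul_le_mul (hB (N+1)) h2 (norm_nonneg _) hB0
      rw [← norm_mul] at h3
      refine (norm_add_le _ _).trans ((add_le_add ih h3).trans (le_of_eq ?_))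
      ring
  have h1 := key N
  have h2 : ‖(∑ n ∈ Finset.range N, b n) * Complex.exp (-(l N : ℂ) * w)‖ ≤ B * 1 := by
    rw [norm_mul]
    refine mul_le_mul (hB N) ?_ (norm_nonneg _) hB0
    rw [Complex.norm_exp]
    simp
    exact mul_nonneg (hnonneg N) hw.le
  have h3 : Real.exp (-l 0 * w.re) - Real.exp (-l N * w.re) ≤ 1 := by
    have : Real.exp (-l 0 * w.re) ≤ 1 := by
      simp; exact mul_nonneg (hnonneg 0) hw.le
    have := Real.exp_pos (-l N * w.re)
    linarith
  have h4 : B * (‖w‖ / w.re * (Real.exp (-l 0 * w.re) - Real.exp (-l N * w.re))) ≤ B * (‖w‖ / w.re * 1) := by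
    gcongr
  have h5 := norm_add_le (∑ n ∈ Finset.range N, b n * Complex.exp (-(l n : ℂ) * w) -
      (∑ n ∈ Finset.range N, b n) * Complex.exp (-(l N : ℂ) * w)) ((∑ n ∈ Finset.range N, b n) * Complex.exp (-(l N : ℂ) * w))
  rw [sub_add_cancel] at h5
  linarith

/-- Linear growth of the partial sums on vertical lines. -/
theorem aux_growth (l : ℕ → ℝ) (hmono : StrictMono l)
    (hnonneg : ∀ n, 0 ≤ l n)
    (a : ℕ → ℂ) (σ₀ : ℝ) (f : ℂ → ℂ)
    (hconv : ∀ s : ℂ, σ₀ < s.re →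
      Tendsto (fun N : ℕ => ∑ n ∈ Finset.range N, a n * Complex.exp (-(l n : ℂ) * s))
        atTop (nhds (f s))) (s : ℂ) (hs : σ₀ < s.re) :
    ∃ C : ℝ, 0 ≤ C ∧ ∀ N : ℕ, ∀ t : ℝ,
      ‖∑ n ∈ Finset.range N, a n * Complex.exp (-(l n : ℂ) * (s + t * Complex.I))‖ ≤ C * (1 + |t|) := by
  obtain ⟨σ, h1, h2⟩ := exists_between hs
  have hb := (hconv (σ : ℂ) (by simpa using h1)).norm.bddAbove_range
  obtain ⟨B, hB⟩ := hb
  have hB' : ∀ N, ‖∑ n ∈ Finset.range N, a n * Complex.exp (-(l n : ℂ) * (σ : ℂ))‖ ≤ B :=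
    fun N => hB ⟨N, rfl⟩
  have hB0 : 0 ≤ B := (norm_nonneg _).trans (hB' 0)
  have hr : 0 < s.re - σ := by linarith
  refine ⟨B + B * ((‖s - σ‖ + 1) / (s.re - σ)), by positivity, fun N t => ?_⟩
  have h3 := aux_abel l hmono hnonneg _ B hB' (s + t * Complex.I - σ) (by simpa using h2) N
  have e : ∀ n, a n * Complex.exp (-(l n : ℂ) * (σ : ℂ)) * Complex.exp (-(l n : ℂ) * (s + t * Complex.I - σ)) =
      a n * Complex.exp (-(l n : ℂ) * (s + t * Complex.I)) := by
    intro n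
    rw [mul_assoc, ← Complex.exp_add]
    congr 2
    ring
  simp only [e] at h3
  refine h3.trans ?_
  have e2 : (s + t * Complex.I - σ).re = s.re - σ := by simp
  rw [e2]
  have h4 : ‖s + t * Complex.I - σ‖ ≤ ‖s - σ‖ + |t| := by
    have : s + t * Complex.I - σ = (s - σ) + t * Complex.I := by ring
    rw [this]
    refine (norm_add_le _ _).trans ?_
    simp
  have h5 : ‖s - σ‖ + |t| ≤ (‖s - σ‖ + 1) * (1 + |t|) := by
    nlinarith [norm_nonneg (s - σ), abs_nonneg t, mul_nonneg (norm_nonneg (s - σ)) (abs_nonneg t)]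
  have h6 : ‖s + t * Complex.I - σ‖ / (s.re - σ) ≤ (‖s - σ‖ + 1) / (s.re - σ) * (1 + |t|) := by
    rw [div_mul_eq_mul_div]
    gcongr
    linarith
  have h7 := mul_le_mul_of_nonneg_left h6 hB0
  nlinarith [mul_nonneg hB0 (abs_nonneg t)]

/-- Identity for kernels with a first moment. -/
theorem aux_ident_moment (l : ℕ → ℝ) (hmono : StrictMono l)
    (hnonneg : ∀ n, 0 ≤ l n)
    (a : ℕ → ℂ) (σ₀ : ℝ) (f : ℂ → ℂ)
    (hconv : ∀ s : ℂ, σ₀ < s.re →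
      Tendsto (fun N : ℕ => ∑ n ∈ Finset.range N, a n * Complex.exp (-(l n : ℂ) * s))
        atTop (nhds (f s))) (s : ℂ) (hs : σ₀ < s.re)
    (φ : ℝ → ℂ) (hφ : Integrable φ) (hφ1 : Integrable (fun t => ‖φ t‖ * (1 + |t|)))
    (N₀ : ℕ) (hN : ∀ n, N₀ ≤ n → fourierT φ (l n) = 0) :
    ∑ n ∈ Finset.range N₀, a n * fourierT φ (l n) * Complex.exp (-(l n : ℂ) * s) =
      ∫ t : ℝ, φ t * f (s + t * Complex.I) := by
  obtain ⟨C, hC, hg⟩ := aux_growth l hmono hnonneg a σ₀ f hconv s hs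
  have hInt : ∀ n, Integrable (fun t : ℝ => φ t * (a n * Complex.exp (-(l n : ℂ) * (s + t * Complex.I)))) := by
    intro n
    refine hφ.mul_bdd (c := ‖a n‖ * Real.exp (- l n * s.re)) ?_ ?_
    · exact (by fun_prop : Continuous _).aestronglyMeasurable
    · refine Eventually.of_forall fun t => ?_
      rw [norm_mul, Complex.norm_exp]
      simp
  have hterm : ∀ n, ∫ t : ℝ, φ t * (a n * Complex.exp (-(l n : ℂ) * (s + t * Complex.I))) =
      a n * fourierT φ (l n) * Complex.exp (-(l n : ℂ) * s) := by
    intro n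
    unfold fourierT
    rw [mul_right_comm, ← integral_const_mul]
    congr 1
    ext t
    have : Complex.exp (-(l n : ℂ) * (s + t * Complex.I)) = Complex.exp (-(l n : ℂ) * s) * Complex.exp (-(l n * t) * Complex.I) := by
      rw [← Complex.exp_add]; congr 1; ring
    rw [this]; ring
  have hsum : ∀ N, ∫ t : ℝ, φ t * ∑ n ∈ Finset.range N, a n * Complex.exp (-(l n : ℂ) * (s + t * Complex.I)) =
      ∑ n ∈ Finset.range N, a n * fourierT φ (l n) * Complex.exp (-(l n : ℂ) * s) := by
    intro N
    simp only [Finset.mul_sum]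
    rw [integral_finsetSum _ (fun n _ => hInt n)]
    exact Finset.sum_congr rfl fun n _ => hterm n
  have hlim : Tendsto (fun N => ∫ t : ℝ, φ t * ∑ n ∈ Finset.range N, a n * Complex.exp (-(l n : ℂ) * (s + t * Complex.I)))
      atTop (nhds (∫ t : ℝ, φ t * f (s + t * Complex.I))) := by
    apply tendsto_integral_of_dominated_convergence (fun t => C * (‖φ t‖ * (1 + |t|)))
    · intro N
      exact hφ.aestronglyMeasurable.mul (by fun_prop : Continuous _).aestronglyMeasurable
    · exact hφ1.const_mul C
    · intro N
      refine Eventually.of_forall fun t => ?_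
      rw [norm_mul]
      have := mul_le_mul_of_nonneg_left (hg N t) (norm_nonneg (φ t))
      linarith
    · refine Eventually.of_forall fun t => ?_
      exact (hconv _ (by simpa using hs)).const_mul _
  refine tendsto_nhds_unique ?_ hlim
  apply tendsto_const_nhds.congr'
  filter_upwards [eventually_ge_atTop N₀] with N hNN
  rw [hsum]
  apply Finset.sum_subset (Finset.range_mono hNN)
  intro n _ hn
  rw [hN n (by simpa using hn)]
  simp

/-- The sinc function as an average of exponentials. -/
theorem aux_sinc (x : ℝ) : (Real.sinc x : ℂ) = (1/2) * ∫ u in (-1:ℝ)..1, Complex.exp (u * x * Complex.I) := by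
  by_cases hx : x = 0
  · subst hx; simp; norm_num
  have h := intervalIntegral.integral_comp_mul_right (a := -1) (b := 1) (fun u : ℝ => Complex.exp (u * Complex.I)) hx
  have h2 := integral_exp_mul_I_eq_sinc x
  simp only [neg_mul, one_mul] at h
  rw [h2] at h
  push_cast at h
  rw [h]
  have : (x : ℂ) ≠ 0 := by exact_mod_cast hx
  rw [Complex.real_smul]
  push_cast
  field_simp

/-- Fourier transform of a kernel multiplied by sinc vanishes outside a slightly larger set. -/
theorem aux_sinc_fourier (ψ : ℝ → ℂ) (hψ : Integrable ψ) (R : ℝ) (hR : ∀ x, R < x → fourierT ψ x = 0)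
    (δ : ℝ) (hδ : 0 < δ) (hδ1 : δ ≤ 1) (x : ℝ) (hx : R + 1 < x) :
    fourierT (fun t => ψ t * (Real.sinc (δ * t) : ℂ)) x = 0 := by
  unfold fourierT
  have e : ∀ t : ℝ, ψ t * (Real.sinc (δ * t) : ℂ) * Complex.exp (-(x * t) * Complex.I) =
      (1/2) * ∫ u in Set.Ioc (-1:ℝ) 1, ψ t * Complex.exp (-(((x - δ * u : ℝ) : ℂ) * t) * Complex.I) := by
    intro t
    rw [aux_sinc, intervalIntegral.integral_of_le (by norm_num)]
    have : ∀ u : ℝ, ψ t * Complex.exp (-(((x - δ * u : ℝ) : ℂ) * t) * Complex.I) =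
        (ψ t * Complex.exp (-(x * t) * Complex.I)) * Complex.exp (u * ((δ * t : ℝ) : ℂ) * Complex.I) := by
      intro u
      rw [mul_assoc, ← Complex.exp_add]; congr 2; push_cast; ring
    simp only [this]
    rw [integral_const_mul]
    ring
  simp only [e]
  rw [integral_const_mul, integral_integral_swap]
  · rw [setIntegral_eq_zero_of_forall_eq_zero]
    · simp
    · intro u hu
      exact hR _ (by nlinarith [hu.1, hu.2])
  · have h1 : Integrable (fun p : ℝ × ℝ => ψ p.1 * (1:ℂ)) (volume.prod (volume.restrict (Set.Ioc (-1:ℝ) 1))) :=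
      hψ.mul_prod (integrable_const (1:ℂ))
    simp only [mul_one] at h1
    refine h1.mul_bdd (c := 1) ?_ ?_
    · exact (by fun_prop : Continuous _).aestronglyMeasurable
    · refine Eventually.of_forall fun p => ?_
      rw [Complex.norm_exp]
      simp

/-- Identity in the half-plane of convergence. -/
theorem aux_ident_far (l : ℕ → ℝ) (hmono : StrictMono l)
    (hnonneg : ∀ n, 0 ≤ l n) 
    (a : ℕ → ℂ) (σ₀ : ℝ) (f : ℂ → ℂ)
    (hconv : ∀ s : ℂ, σ₀ < s.re →
      Tendsto (fun N : ℕ => ∑ n ∈ Finset.range N, a n * Complex.exp (-(l n : ℂ) * s))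
        atTop (nhds (f s)))
    (hf : DifferentiableOn ℂ f {s : ℂ | 0 < s.re})
    (M : ℝ) (hM : ∀ s : ℂ, 0 < s.re → ‖f s‖ ≤ M)
    (ψ : ℝ → ℂ) (hψ : Integrable ψ) (R : ℝ) (hR : ∀ x, R < x → fourierT ψ x = 0)
    (N₀ : ℕ) (hN : ∀ n, N₀ ≤ n → R + 1 < l n) (s : ℂ) (hs : σ₀ < s.re) (hs0 : 0 < s.re) :
    ∑ n ∈ Finset.range N₀, a n * fourierT ψ (l n) * Complex.exp (-(l n : ℂ) * s) =
      ∫ t : ℝ, ψ t * f (s + t * Complex.I) := by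
  have hfc : Continuous (fun t : ℝ => f (s + t * Complex.I)) :=
    hf.continuousOn.comp_continuous (by fun_prop) (fun t => by simpa using hs0)
  let δ : ℕ → ℝ := fun k => 1 / ((k : ℝ) + 1)
  have hδ0 : ∀ k, 0 < δ k := fun k => by positivity
  have hδ1 : ∀ k, δ k ≤ 1 := fun k => by
    simp only [δ]; rw [div_le_one (by positivity)]; linarith [Nat.cast_nonneg (α := ℝ) k]
  have hδt : Tendsto δ atTop (nhds 0) := tendsto_one_div_add_atTop_nhds_zero_nat
  have hsb : ∀ x, ‖(Real.sinc x : ℂ)‖ ≤ 1 := fun x => by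
    rw [Complex.norm_real]; exact Real.abs_sinc_le_one x
  have hsc : Continuous Real.sinc := Real.continuous_sinc
  have hscont : ∀ k, Continuous (fun t : ℝ => (Real.sinc (δ k * t) : ℂ)) := fun k => by fun_prop
  have hInt : ∀ k, Integrable (fun t => ψ t * (Real.sinc (δ k * t) : ℂ)) := fun k =>
    hψ.mul_bdd (c := 1) (hscont k).aestronglyMeasurable (Eventually.of_forall fun t => hsb _)
  have hInt1 : ∀ k, Integrable (fun t => ‖ψ t * (Real.sinc (δ k * t) : ℂ)‖ * (1 + |t|)) := by
    intro k
    have : Integrable (fun t => ‖ψ t‖ * (‖(Real.sinc (δ k * t) : ℂ)‖ * (1 + |t|))) := by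
      refine hψ.norm.mul_bdd (c := 1 + 1 / δ k) ?_ ?_
      · exact ((hscont k).norm.mul (by fun_prop)).aestronglyMeasurable
      · refine Eventually.of_forall fun t => ?_
        have h1 := hsb (δ k * t)
        have h2 : ‖(Real.sinc (δ k * t) : ℂ)‖ * |t| ≤ 1 / δ k := by
          rw [le_div_iff₀ (hδ0 k), Complex.norm_real, Real.norm_eq_abs]
          by_cases ht : t = 0
          · simp [ht]
          have hne : δ k * t ≠ 0 := mul_ne_zero (hδ0 k).ne' ht
          rw [Real.sinc_of_ne_zero hne, abs_div, mul_assoc]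
          have : |t| * δ k = |δ k * t| := by rw [abs_mul, abs_of_pos (hδ0 k), mul_comm]
          rw [this, div_mul_cancel₀ _ (abs_ne_zero.mpr hne)]
          exact Real.abs_sin_le_one _
        rw [Real.norm_of_nonneg (by positivity)]
        linarith
    refine this.congr (Eventually.of_forall fun t => ?_)
    simp only [norm_mul]; ring
  have hid := fun k => aux_ident_moment l hmono hnonneg a σ₀ f hconv s hs _ (hInt k) (hInt1 k) N₀
    (fun n hn => aux_sinc_fourier ψ hψ R hR (δ k) (hδ0 k) (hδ1 k) (l n) (hN n hn))
  have hpt : ∀ t : ℝ, Tendsto (fun k => ψ t * (Real.sinc (δ k * t) : ℂ)) atTop (nhds (ψ t)) := by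
    intro t
    have h1 : Tendsto (fun k => Real.sinc (δ k * t)) atTop (nhds 1) := by
      have := (hsc.tendsto (0 * t)).comp (hδt.mul_const t)
      simpa [Function.comp_def] using this
    have h2 : Tendsto (fun k => (Real.sinc (δ k * t) : ℂ)) atTop (nhds ((1:ℝ):ℂ)) :=
      (Complex.continuous_ofReal.tendsto _).comp h1
    simpa using h2.const_mul (ψ t)
  have hpb : ∀ k t, ‖ψ t * (Real.sinc (δ k * t) : ℂ)‖ ≤ ‖ψ t‖ := fun k t => by
    rw [norm_mul]; exact mul_le_of_le_one_right (norm_nonneg _) (hsb _)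
  have hgen : ∀ (g : ℝ → ℂ) (K : ℝ), Continuous g → (∀ t, ‖g t‖ ≤ K) →
      Tendsto (fun k => ∫ t, ψ t * (Real.sinc (δ k * t) : ℂ) * g t) atTop (nhds (∫ t, ψ t * g t)) := by
    intro g K hg hK
    apply tendsto_integral_of_dominated_convergence (fun t => ‖ψ t‖ * K)
    · intro k
      exact (hInt k).aestronglyMeasurable.mul hg.aestronglyMeasurable
    · exact hψ.norm.mul_const K
    · intro k
      refine Eventually.of_forall fun t => ?_
      rw [norm_mul]
      exact mul_le_mul (hpb k t) (hK t) (norm_nonneg _) (norm_nonneg _)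
    · exact Eventually.of_forall fun t => (hpt t).mul_const _
  have hR1 := hgen (fun t : ℝ => f (s + t * Complex.I)) M hfc (fun t => hM _ (by simpa using hs0))
  refine tendsto_nhds_unique ?_ hR1
  refine Tendsto.congr hid ?_
  apply tendsto_finsetSum
  intro n _
  apply Tendsto.mul_const
  apply Tendsto.const_mul
  exact hgen (fun t : ℝ => Complex.exp (-(l n * t) * Complex.I)) 1 (by fun_prop) (fun t => by
    rw [Complex.norm_exp]; simp)

/-- Cauchy estimate. -/
theorem aux_cauchy (f : ℂ → ℂ) (hf : DifferentiableOn ℂ f {s : ℂ | 0 < s.re})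
    (M : ℝ) (hM : ∀ s : ℂ, 0 < s.re → ‖f s‖ ≤ M) (r : ℝ) (hr : 0 < r) (s : ℂ) (hs : r < s.re) :
    ‖deriv f s‖ ≤ M / r := by
  have hsub : Metric.closedBall s r ⊆ {s : ℂ | 0 < s.re} := by
    intro z hz
    rw [Metric.mem_closedBall, Complex.dist_eq] at hz
    have h1 := (Complex.abs_re_le_norm (z - s)).trans hz
    rw [Complex.sub_re, abs_le] at h1
    change 0 < z.re
    linarith [h1.1]
  apply Complex.norm_deriv_le_of_forall_mem_sphere_norm_le hr
  · apply DifferentiableOn.diffContOnCl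
    exact hf.mono (Metric.closure_ball_subset_closedBall.trans hsub)
  · exact fun z hz => hM z (hsub (Metric.sphere_subset_closedBall hz))

theorem aux_open : IsOpen {s : ℂ | 0 < s.re} := isOpen_lt continuous_const Complex.continuous_re

/-- Holomorphy of the convolution. -/
theorem aux_conv_diff (f : ℂ → ℂ) (hf : DifferentiableOn ℂ f {s : ℂ | 0 < s.re})
    (M : ℝ) (hM : ∀ s : ℂ, 0 < s.re → ‖f s‖ ≤ M) (ψ : ℝ → ℂ) (hψ : Integrable ψ) :
    DifferentiableOn ℂ (fun s => ∫ t : ℝ, ψ t * f (s + t * Complex.I)) {s : ℂ | 0 < s.re} := by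
  intro s hs
  apply DifferentiableAt.differentiableWithinAt
  have hs' : 0 < s.re := hs
  have hfc : ∀ z : ℂ, 0 < z.re → Continuous (fun t : ℝ => f (z + t * Complex.I)) := fun z hz =>
    hf.continuousOn.comp_continuous (by fun_prop) (fun t => by simpa using hz)
  have hdc : Continuous (fun t : ℝ => deriv f (s + t * Complex.I)) :=
    (hf.deriv aux_open).continuousOn.comp_continuous (by fun_prop) (fun t => by simpa using hs')
  have hmem : {z : ℂ | s.re / 2 < z.re} ∈ nhds s :=
    (isOpen_lt continuous_const Complex.continuous_re).mem_nhds (by simp; linarith)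
  have := hasDerivAt_integral_of_dominated_loc_of_deriv_le (μ := volume) (𝕜 := ℂ)
    (F := fun (z : ℂ) (t : ℝ) => ψ t * f (z + t * Complex.I))
    (F' := fun (z : ℂ) (t : ℝ) => ψ t * deriv f (z + t * Complex.I)) (x₀ := s)
    (bound := fun t => ‖ψ t‖ * (M / (s.re / 2))) hmem ?_ ?_ ?_ ?_ ?_ ?_
  · exact this.2.differentiableAt
  · filter_upwards [aux_open.mem_nhds hs] with z hz
    exact hψ.aestronglyMeasurable.mul (hfc z hz).aestronglyMeasurable
  · exact hψ.mul_bdd (c := M) (hfc s hs).aestronglyMeasurable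
      (Eventually.of_forall fun t => hM _ (by simpa using hs'))
  · exact hψ.aestronglyMeasurable.mul hdc.aestronglyMeasurable
  · refine Eventually.of_forall fun t z hz => ?_
    rw [norm_mul]
    refine mul_le_mul_of_nonneg_left ?_ (norm_nonneg _)
    exact aux_cauchy f hf M hM _ (by linarith) _ (by simpa using hz)
  · exact hψ.norm.mul_const _
  · refine Eventually.of_forall fun t z hz => ?_
    have hz' : s.re / 2 < z.re := hz
    have hz0 : 0 < (z + t * Complex.I).re := by simp; linarith
    have hd : HasDerivAt f (deriv f (z + t * Complex.I)) (z + t * Complex.I) :=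
      (hf.differentiableAt (aux_open.mem_nhds hz0)).hasDerivAt
    exact (hd.comp_add_const z _).const_mul _

/-- The key identity on the whole half-plane. -/
theorem aux_ident (l : ℕ → ℝ) (hmono : StrictMono l)
    (hnonneg : ∀ n, 0 ≤ l n) (htend : Tendsto l atTop atTop)
    (a : ℕ → ℂ) (σ₀ : ℝ) (f : ℂ → ℂ)
    (hconv : ∀ s : ℂ, σ₀ < s.re →
      Tendsto (fun N : ℕ => ∑ n ∈ Finset.range N, a n * Complex.exp (-(l n : ℂ) * s))
        atTop (nhds (f s)))
    (hf : DifferentiableOn ℂ f {s : ℂ | 0 < s.re})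
    (M : ℝ) (hM : ∀ s : ℂ, 0 < s.re → ‖f s‖ ≤ M)
    (ψ : ℝ → ℂ) (hψ : Integrable ψ) (R : ℝ) (hR : ∀ x, R < x → fourierT ψ x = 0)
    (s : ℂ) (hs0 : 0 < s.re) :
    ∑' n : ℕ, a n * fourierT ψ (l n) * Complex.exp (-(l n : ℂ) * s) =
      ∫ t : ℝ, ψ t * f (s + t * Complex.I) := by
  obtain ⟨N₀, hN⟩ := eventually_atTop.mp (htend.eventually (eventually_gt_atTop (R + 1)))
  rw [tsum_eq_sum (s := Finset.range N₀)]
  swap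
  · intro n hn
    rw [hR (l n) (by linarith [hN n (by simpa using hn)])]
    simp
  have h1 : DifferentiableOn ℂ (fun s => ∑ n ∈ Finset.range N₀, a n * fourierT ψ (l n) * Complex.exp (-(l n : ℂ) * s))
      {s : ℂ | 0 < s.re} := by
    apply Differentiable.differentiableOn
    fun_prop
  have h2 := aux_conv_diff f hf M hM ψ hψ
  have hconvex : Convex ℝ {s : ℂ | 0 < s.re} := convex_halfSpace_re_gt 0
  let z₀ : ℂ := ((max σ₀ 0 + 1 : ℝ) : ℂ)
  have hz1 : σ₀ < z₀.re := by simp only [z₀, Complex.ofReal_re]; linarith [le_max_left σ₀ 0]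
  have hz0 : 0 < z₀.re := by simp only [z₀, Complex.ofReal_re]; linarith [le_max_right σ₀ 0]
  refine (h1.analyticOnNhd aux_open).eqOn_of_preconnected_of_eventuallyEq (h2.analyticOnNhd aux_open)
    hconvex.isPreconnected (z₀ := z₀) hz0 ?_ hs0
  filter_upwards [aux_open.mem_nhds hz0,
    (isOpen_lt continuous_const Complex.continuous_re).mem_nhds hz1] with z hz hz'
  exact aux_ident_far l hmono hnonneg a σ₀ f hconv hf M hM ψ hψ R hR N₀ (fun n hn => hN n hn) z hz' hz

theorem aux_scale (ψ : ℝ → ℂ) (g : ℝ → ℂ) (c : ℝ) (hc : 0 < c) :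
    ∫ t : ℝ, (c : ℂ) * ψ (c * t) * g t = ∫ u : ℝ, ψ u * g (u / c) := by
  have h := Measure.integral_comp_mul_left (fun u : ℝ => (c : ℂ) * ψ u * g (u / c)) c
  have e : ∀ t : ℝ, c * t / c = t := fun t => by field_simp
  simp only [e] at h
  rw [h, ← integral_smul]
  congr 1
  ext u
  rw [abs_of_pos (inv_pos.mpr hc), Complex.real_smul]
  have : (c : ℂ) ≠ 0 := by exact_mod_cast hc.ne'
  push_cast
  field_simp

/-- If `D = ∑ aₙ e^{−λₙ s}` converges on `[Re s > σ₀]` and extends to a bounded holomorphic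
function `f` on `[Re s > 0]`, and `ψ ∈ L¹(ℝ)` has compactly supported Fourier transform, then
(i) `sup_{Re s > 0} |R_ψ(D)(s)| ≤ ‖ψ‖₁ ‖f‖_∞`, and (ii) if `∫ψ = 1` then, with
`ψ_N(t) = Nψ(Nt)` (so `ψ̂_N(x) = ψ̂(x/N)`), the polynomials `R_{ψ_N}(D)` converge uniformly
to `f` on every half-plane `[Re s > ε]`, `ε > 0`. -/
theorem rpsi_bound_and_uniform_convergence (l : ℕ → ℝ) (hmono : StrictMono l)
    (hnonneg : ∀ n, 0 ≤ l n) (htend : Tendsto l atTop atTop)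
    (a : ℕ → ℂ) (σ₀ : ℝ) (f : ℂ → ℂ)
    (hconv : ∀ s : ℂ, σ₀ < s.re →
      Tendsto (fun N : ℕ => ∑ n ∈ Finset.range N, a n * Complex.exp (-(l n : ℂ) * s))
        atTop (nhds (f s)))
    (hf : DifferentiableOn ℂ f {s : ℂ | 0 < s.re})
    (hbdd : ∃ M : ℝ, ∀ s : ℂ, 0 < s.re → ‖f s‖ ≤ M)
    (ψ : ℝ → ℂ) (hψ : Integrable ψ) (hsupp : HasCompactSupport (fourierT ψ)) :
    -- (i)
    (∀ M : ℝ, (∀ s : ℂ, 0 < s.re → ‖f s‖ ≤ M) → ∀ s : ℂ, 0 < s.re →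
      ‖∑' n : ℕ, a n * fourierT ψ (l n) * Complex.exp (-(l n : ℂ) * s)‖ ≤
        (∫ t : ℝ, ‖ψ t‖) * M) ∧
    -- (ii)
    ((∫ t : ℝ, ψ t) = 1 → ∀ ε > (0 : ℝ),
      TendstoUniformlyOn
        (fun (N : ℕ) (s : ℂ) =>
          ∑' n : ℕ, a n * fourierT ψ (l n / N) * Complex.exp (-(l n : ℂ) * s))
        f atTop {s : ℂ | ε < s.re}) := by
  obtain ⟨R, hR⟩ : ∃ R : ℝ, ∀ x, R < x → fourierT ψ x = 0 := by
    obtain ⟨R, hR⟩ := hsupp.isCompact.bddAbove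
    refine ⟨R, fun x hx => ?_⟩
    by_contra h
    exact absurd (hR (subset_tsupport _ h)) (not_le.mpr hx)
  have hfc : ∀ z : ℂ, 0 < z.re → Continuous (fun t : ℝ => f (z + t * Complex.I)) := fun z hz =>
    hf.continuousOn.comp_continuous (by fun_prop) (fun t => by simpa using hz)
  constructor
  · intro M hM s hs
    rw [aux_ident l hmono hnonneg htend a σ₀ f hconv hf M hM ψ hψ R hR s hs, ← integral_mul_const]
    refine norm_integral_le_of_norm_le (hψ.norm.mul_const M) (Eventually.of_forall fun t => ?_)
    rw [norm_mul]
    exact mul_le_mul_of_nonneg_left (hM _ (by simpa using hs)) (norm_nonneg _)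
  · intro h1 ε hε
    obtain ⟨M, hM⟩ := hbdd
    have hM0 : 0 ≤ M := (norm_nonneg _).trans (hM 1 (by simp))
    let b : ℕ → ℝ → ℝ := fun N u => min (2 * M) (M / ε * (|u| / N))
    have hb0 : ∀ N u, 0 ≤ b N u := fun N u => le_min (by positivity) (by positivity)
    have hbm : ∀ N, AEStronglyMeasurable (fun u => ‖ψ u‖ * b N u) volume := fun N =>
      hψ.norm.aestronglyMeasurable.mul (by simp only [b]; fun_prop : Continuous (b N)).aestronglyMeasurable
    have hbb : ∀ N u, ‖‖ψ u‖ * b N u‖ ≤ ‖ψ u‖ * (2 * M) := fun N u => by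
      rw [Real.norm_of_nonneg (mul_nonneg (norm_nonneg _) (hb0 N u))]
      exact mul_le_mul_of_nonneg_left (min_le_left _ _) (norm_nonneg _)
    have hbi : ∀ N, Integrable (fun u => ‖ψ u‖ * b N u) := fun N =>
      (hψ.norm.mul_const (2 * M)).mono' (hbm N) (Eventually.of_forall (hbb N))
    have hlim : Tendsto (fun N => ∫ u, ‖ψ u‖ * b N u) atTop (nhds 0) := by
      have : Tendsto (fun N => ∫ u, ‖ψ u‖ * b N u) atTop (nhds (∫ _ : ℝ, (0:ℝ))) := by
        apply tendsto_integral_of_dominated_convergence (fun u => ‖ψ u‖ * (2 * M)) hbm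
          (hψ.norm.mul_const (2 * M)) (fun N => Eventually.of_forall (hbb N))
        refine Eventually.of_forall fun u => ?_
        have h2 : Tendsto (fun N : ℕ => M / ε * (|u| / N)) atTop (nhds 0) := by
          simpa using (tendsto_const_div_atTop_nhds_zero_nat |u|).const_mul (M / ε)
        have h3 : Tendsto (fun N => b N u) atTop (nhds 0) :=
          squeeze_zero (fun N => hb0 N u) (fun N => min_le_right _ _) h2
        simpa using h3.const_mul ‖ψ u‖
      simpa using this
    have hlip : ∀ s : ℂ, ε < s.re → ∀ v : ℝ, ‖f (s + v * Complex.I) - f s‖ ≤ M / ε * |v| := by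
      intro s hs v
      have := (convex_halfSpace_re_gt ε).norm_image_sub_le_of_norm_deriv_le (𝕜 := ℂ) (f := f) (C := M / ε)
        (x := s) (y := s + v * Complex.I)
        (fun z hz => hf.differentiableAt (aux_open.mem_nhds (hε.trans hz)))
        (fun z hz => aux_cauchy f hf M hM ε hε z hz) hs (show ε < (s + v * Complex.I).re by simpa using hs)
      simpa using this
    have hmain : ∀ N : ℕ, 0 < N → ∀ s : ℂ, ε < s.re →
        ‖(∑' n : ℕ, a n * fourierT ψ (l n / N) * Complex.exp (-(l n : ℂ) * s)) - f s‖ ≤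
          ∫ u, ‖ψ u‖ * b N u := by
      intro N hN s hs
      have hN' : (0:ℝ) < N := by exact_mod_cast hN
      have hs0 : 0 < s.re := hε.trans hs
      let φ : ℝ → ℂ := fun t => ((N : ℝ) : ℂ) * ψ (N * t)
      have hφ : Integrable φ := (hψ.comp_mul_left' hN'.ne').const_mul _
      have hφT : ∀ x : ℝ, fourierT φ x = fourierT ψ (x / N) := by
        intro x
        have := aux_scale ψ (fun t : ℝ => Complex.exp (-(x * t) * Complex.I)) N hN'
        unfold fourierT
        refine this.trans ?_
        congr 1
        ext u
        congr 2
        push_cast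
        ring
      have hid := aux_ident l hmono hnonneg htend a σ₀ f hconv hf M hM φ hφ (R * N)
        (fun x hx => by rw [hφT]; exact hR _ ((lt_div_iff₀ hN').mpr hx)) s hs0
      simp only [hφT] at hid
      rw [hid, aux_scale ψ (fun t : ℝ => f (s + t * Complex.I)) N hN']
      have e1 : f s = ∫ u, ψ u * f s := by rw [integral_mul_const, h1, one_mul]
      have hi1 : Integrable (fun u : ℝ => ψ u * f (s + ((u / N : ℝ) : ℂ) * Complex.I)) :=
        hψ.mul_bdd (c := M) ((hfc s hs0).comp (by fun_prop : Continuous fun u : ℝ => u / (N:ℝ))).aestronglyMeasurable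
          (Eventually.of_forall fun t => hM _ (by simpa using hs0))
      rw [e1, ← integral_sub hi1 (hψ.mul_const _)]
      refine norm_integral_le_of_norm_le (hbi N) (Eventually.of_forall fun u => ?_)
      rw [← mul_sub, norm_mul]
      refine mul_le_mul_of_nonneg_left (le_min ?_ ?_) (norm_nonneg _)
      · refine (norm_sub_le _ _).trans ?_
        have h2 := hM (s + ((u / N : ℝ) : ℂ) * Complex.I) (by simpa using hs0)
        have h3 := hM s hs0
        linarith
      · have := hlip s hs (u / N)
        rwa [abs_div, abs_of_pos hN'] at this
    rw [Metric.tendstoUniformlyOn_iff]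
    intro η hη
    filter_upwards [hlim.eventually (gt_mem_nhds hη), eventually_gt_atTop 0] with N h2 h3 s hs
    rw [dist_comm, dist_eq_norm]
    exact (hmain N h3 s hs).trans_lt h2
end

section
/- There exists an absolute constant C > 0 with the following property. Let λ be a frequency, let (a_n) be complex coefficients such that the λ-Dirichlet series D = ∑_{n≥1} a_n e^{−λ_n s} converges for all s with Re s > σ₀, and let f be a bounded holomorphic function on C_0 = {Re s > 0} with f(s) = ∑_{n≥1} a_n e^{−λ_n s} for Re s > σ₀; set ‖f‖_∞ := sup_{Re s>0}|f(s)|. Then for all integers M > N ≥ 1, sup_{Re s>0} |∑_{n=1}^N a_n e^{−λ_n s}| ≤ C·( log((λ_M + λ_N)/(λ_M − λ_N)) + (M − N − 1) + 1 )·‖f‖_∞. -/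
open Filter

section Helpers
open MeasureTheory

def qq (c x : ℝ) : ℝ := (max (c - |x|) 0) ^ 2

lemma qq_cont (c : ℝ) : Continuous (qq c) := by unfold qq; fun_prop

lemma qq_zero {c x : ℝ} (h : c ≤ |x|) : qq c x = 0 := by
  unfold qq; rw [max_eq_right (by linarith)]; simp

lemma qq_of_le {c x : ℝ} (h : |x| ≤ c) : qq c x = (c - |x|)^2 := by
  unfold qq; rw [max_eq_left (by linarith)]

lemma qq_half (c : ℝ) (μ : ℂ) (hμ : μ ≠ 0) :
    ∫ x in (0:ℝ)..c, Complex.exp (μ * x) * ((c - x : ℝ) : ℂ)^2 =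
      2 * Complex.exp (μ * c) / μ^3 - c^2/μ - 2*c/μ^2 - 2/μ^3 := by
  have hd : ∀ x : ℝ, HasDerivAt (fun x : ℝ => Complex.exp (μ * x) *
      (((c:ℂ) - x)^2/μ + 2*((c:ℂ)-x)/μ^2 + 2/μ^3))
      (Complex.exp (μ * x) * ((c - x : ℝ) : ℂ)^2) x := by
    intro x
    have h0 : HasDerivAt (fun x : ℝ => (x:ℂ)) 1 x := Complex.ofRealCLM.hasDerivAt
    have h1 : HasDerivAt (fun x : ℝ => Complex.exp (μ * x)) (Complex.exp (μ * x) * (μ * 1)) x :=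
      (h0.const_mul μ).cexp
    have h2 := (h0.const_sub (c:ℂ))
    have h3 := h1.mul ((((h2.pow 2).div_const μ).add ((h2.const_mul 2).div_const (μ^2))).add_const (2/μ^3))
    refine (h3.congr_deriv ?_)
    push_cast
    simp
    field_simp
    ring
  rw [intervalIntegral.integral_eq_sub_of_hasDerivAt (fun x _ => hd x)]
  · simp
    field_simp
    ring
  · apply Continuous.intervalIntegrable
    fun_prop

lemma qq_supp {c : ℝ} : HasCompactSupport (qq c) := by
  apply HasCompactSupport.of_support_subset_isCompact (isCompact_Icc (a := -c) (b := c))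
  intro x hx
  by_contra h
  apply hx
  apply qq_zero
  by_contra h2
  push Not at h2
  exact h ⟨by linarith [neg_abs_le x], by linarith [le_abs_self x]⟩

lemma qq_integrable (c : ℝ) (μ : ℂ) :
    Integrable (fun x : ℝ => Complex.exp (μ * x) * (qq c x : ℂ)) := by
  apply Continuous.integrable_of_hasCompactSupport
  · have := qq_cont c
    fun_prop
  · apply HasCompactSupport.mul_left
    exact (qq_supp (c := c)).comp_left (g := fun x : ℝ => (x:ℂ)) (by simp)

lemma qq_int (c : ℝ) (hc : 0 ≤ c) (μ : ℂ) (hμ : μ ≠ 0) :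
    ∫ x : ℝ, Complex.exp (μ * x) * (qq c x : ℂ) =
      2 * (Complex.exp (μ * c) - Complex.exp (-(μ * c))) / μ^3 - 4*c/μ^2 := by
  have e1 : ∫ x : ℝ, Complex.exp (μ * x) * (qq c x : ℂ) =
      ∫ x in (-c)..c, Complex.exp (μ * x) * (qq c x : ℂ) := by
    symm
    apply intervalIntegral.integral_eq_integral_of_support_subset
    intro x hx
    by_contra h
    apply hx
    simp only
    rw [qq_zero, Complex.ofReal_zero, mul_zero]
    by_contra h2
    push Not at h2
    exact h ⟨by linarith [neg_abs_le x], by linarith [le_abs_self x]⟩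
  have e2 : ∀ ν : ℂ, ν ≠ 0 → ∫ x in (0:ℝ)..c, Complex.exp (ν * x) * (qq c x : ℂ) =
      2 * Complex.exp (ν * c) / ν^3 - c^2/ν - 2*c/ν^2 - 2/ν^3 := by
    intro ν hν
    rw [← qq_half c ν hν]
    apply intervalIntegral.integral_congr
    intro x hx
    rw [Set.uIcc_of_le hc] at hx
    simp only
    rw [qq_of_le (by rw [abs_of_nonneg hx.1]; exact hx.2), abs_of_nonneg hx.1]
    push_cast
    rfl
  have e3 : ∫ x in (-c)..0, Complex.exp (μ * x) * (qq c x : ℂ) =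
      ∫ x in (0:ℝ)..c, Complex.exp ((-μ) * x) * (qq c x : ℂ) := by
    have := intervalIntegral.integral_comp_neg (a := 0) (b := c)
      (fun x : ℝ => Complex.exp (μ * x) * (qq c x : ℂ))
    rw [neg_zero] at this
    rw [← this]
    congr 1
    ext x
    simp [qq]
  rw [e1, ← intervalIntegral.integral_add_adjacent_intervals (b := 0)
    (qq_integrable c μ).intervalIntegrable (qq_integrable c μ).intervalIntegrable, e3,
    e2 _ (neg_ne_zero.mpr hμ), e2 _ hμ]
  rw [neg_mul]
  field_simp
  ring

noncomputable def Phi (a b x : ℝ) : ℝ :=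
  2/(b-a)^2 * (qq b x - 2 * qq ((a+b)/2) x + qq a x)

lemma Phi_one {a b x : ℝ} (hab : a < b) (hx : |x| ≤ a) : Phi a b x = 1 := by
  unfold Phi
  rw [qq_of_le hx, qq_of_le (by linarith), qq_of_le (by linarith)]
  have : b - a ≠ 0 := by linarith
  field_simp
  ring

lemma Phi_zero {a b x : ℝ} (hab : a < b) (hx : b ≤ |x|) : Phi a b x = 0 := by
  unfold Phi
  rw [qq_zero hx, qq_zero (by linarith), qq_zero (by linarith)]
  ring

lemma Phi_abs {a b x : ℝ} (hab : a < b) : |Phi a b x| ≤ 1 := by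
  rcases le_total (|x|) a with h | h
  · rw [Phi_one hab h]; simp
  rcases le_total b (|x|) with h' | h'
  · rw [Phi_zero hab h']; simp
  have h0 : 0 < (b - a)^2 := by have : 0 < b - a := by linarith
                                positivity
  unfold Phi
  rw [qq_zero h, qq_of_le h', div_mul_eq_mul_div, abs_le, le_div_iff₀ h0, div_le_iff₀ h0]
  rcases le_total (|x|) ((a+b)/2) with h2 | h2
  · rw [qq_of_le h2]
    constructor <;> nlinarith
  · rw [qq_zero h2]
    constructor <;> nlinarith

lemma Phi_cont (a b : ℝ) : Continuous (Phi a b) := by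
  have := qq_cont
  unfold Phi; fun_prop

lemma Phi_fourier {a b : ℝ} (ha : 0 ≤ a) (hab : a < b) (w : ℝ) (hw : w ≠ 0) :
    FourierTransform.fourier (fun x : ℝ => (Phi a b x : ℂ)) w =
     ((8 * Real.sin ((a+b)/2 * (2 * Real.pi * w)) * Real.sin ((b-a)/4 * (2 * Real.pi * w))^2
        / (((b-a)/2)^2 * (2*Real.pi*w)^3) : ℝ) : ℂ) := by
  rw [Real.fourier_real_eq_integral_exp_smul]
  set t : ℝ := 2 * Real.pi * w with ht
  have ht0 : t ≠ 0 := by positivity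
  have htc : (t:ℂ) ≠ 0 := by exact_mod_cast ht0
  set μ : ℂ := -(t * Complex.I) with hμ
  have hμ0 : μ ≠ 0 := by simp [hμ, ht0]
  have e1 : ∀ v : ℝ, Complex.exp (↑(-2 * Real.pi * v * w) * Complex.I) • (Phi a b v : ℂ) =
      (2/(b-a)^2 : ℂ) * (Complex.exp (μ * v) * (qq b v : ℂ) - 2 * (Complex.exp (μ * v) * (qq ((a+b)/2) v : ℂ))
        + Complex.exp (μ * v) * (qq a v : ℂ)) := by
    intro v
    have : (↑(-2 * Real.pi * v * w) * Complex.I : ℂ) = μ * v := by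
      simp only [hμ, ht]; push_cast; ring
    rw [this, Phi, smul_eq_mul]
    push_cast
    ring
  simp_rw [e1]
  have hi1 : Integrable (fun v : ℝ => Complex.exp (μ * v) * (qq b v : ℂ) -
      2 * (Complex.exp (μ * v) * (qq ((a+b)/2) v : ℂ))) :=
    (qq_integrable b μ).sub ((qq_integrable _ μ).const_mul 2)
  rw [integral_const_mul, integral_add hi1 (qq_integrable a μ),
    integral_sub (qq_integrable b μ) ((qq_integrable _ μ).const_mul 2), integral_const_mul,
    qq_int b (by linarith) μ hμ0, qq_int a ha μ hμ0, qq_int ((a+b)/2) (by linarith) μ hμ0]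
  have key : ∀ c : ℝ, Complex.exp (μ * c) - Complex.exp (-(μ * c)) = -(2 * Complex.I * (Real.sin (c * t) : ℝ)) := by
    intro c
    have h1 : μ * c = ((-(c*t) : ℝ) : ℂ) * Complex.I := by simp only [hμ]; push_cast; ring
    have h2 : -(μ * c) = (((c*t) : ℝ) : ℂ) * Complex.I := by simp only [hμ]; push_cast; ring
    rw [h2, h1, Complex.exp_mul_I, Complex.exp_mul_I, ← Complex.ofReal_cos, ← Complex.ofReal_cos,
      ← Complex.ofReal_sin, ← Complex.ofReal_sin, Real.sin_neg, Real.cos_neg]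
    push_cast
    ring
  rw [key a, key b, key ((a+b)/2)]
  have hμ2 : μ^2 = -(t:ℂ)^2 := by simp only [hμ]; ring_nf; rw [Complex.I_sq]; ring
  have hμ3 : μ^3 = Complex.I * (t:ℂ)^3 := by
    rw [pow_succ, hμ2]; simp only [hμ]; ring
  rw [hμ2, hμ3]
  have trig : Real.sin (b*t) - 2 * Real.sin ((a+b)/2*t) + Real.sin (a*t) =
      -4 * Real.sin ((a+b)/2*t) * Real.sin ((b-a)/4*t)^2 := by
    have h1 : b * t = (a+b)/2*t + 2 * ((b-a)/4*t) := by ring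
    have h2 : a * t = (a+b)/2*t - 2 * ((b-a)/4*t) := by ring
    rw [h1, h2, Real.sin_add, Real.sin_sub, Real.cos_two_mul, Real.cos_sq']
    ring
  have trig' : (Real.sin (a*t) : ℂ) = -4 * Real.sin ((a+b)/2*t) * Real.sin ((b-a)/4*t)^2
     - Real.sin (b*t) + 2 * Real.sin ((a+b)/2*t) := by
    have : Real.sin (a*t) = -4 * Real.sin ((a+b)/2*t) * Real.sin ((b-a)/4*t)^2
      - Real.sin (b*t) + 2 * Real.sin ((a+b)/2*t) := by linarith
    rw [this]; push_cast; ring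
  rw [trig']
  have hba : (b:ℂ) - a ≠ 0 := by
    have : b - a ≠ 0 := by linarith
    exact_mod_cast this
  push_cast
  have hI : Complex.I ≠ 0 := Complex.I_ne_zero
  generalize Complex.sin (((a:ℂ)+b)/2*t) = S1
  generalize Complex.sin (((b:ℂ)-a)/4*t) = S2
  generalize Complex.sin ((b:ℂ)*t) = S3
  field_simp
  ring

lemma Phi_fourier_bound1 {a b : ℝ} (ha : 0 ≤ a) (hab : a < b) (w : ℝ) (hw : w ≠ 0) :
    ‖FourierTransform.fourier (fun x : ℝ => (Phi a b x : ℂ)) w‖ ≤ a + b := by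
  rw [Phi_fourier ha hab w hw, Complex.norm_real, Real.norm_eq_abs]
  set t : ℝ := 2 * Real.pi * w with ht
  have ht0 : 0 < |t| := abs_pos.mpr (by positivity)
  have h1 : |Real.sin ((a+b)/2*t)| ≤ (a+b)/2*|t| := by
    refine Real.abs_sin_le_abs.trans ?_
    rw [abs_mul, abs_of_nonneg (by linarith : 0 ≤ (a+b)/2)]
  have h2 : |Real.sin ((b-a)/4*t)| ≤ (b-a)/4*|t| := by
    refine Real.abs_sin_le_abs.trans ?_
    rw [abs_mul, abs_of_nonneg (by linarith : 0 ≤ (b-a)/4)]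
  have hba : 0 < b - a := by linarith
  rw [abs_div, abs_mul, abs_mul, abs_pow, abs_mul, abs_pow, abs_pow, abs_of_pos (by positivity : (0:ℝ) < 8),
    abs_of_pos (by positivity : 0 < (b-a)/2), div_le_iff₀ (by positivity)]
  calc 8 * |Real.sin ((a+b)/2*t)| * |Real.sin ((b-a)/4*t)|^2 ≤
      8 * ((a+b)/2*|t|) * ((b-a)/4*|t|)^2 := by
        have : 0 ≤ a + b := by linarith
        gcongr
    _ = _ := by ring

lemma Phi_fourier_bound2 {a b : ℝ} (ha : 0 ≤ a) (hab : a < b) (w : ℝ) (hw : w ≠ 0) :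
    ‖FourierTransform.fourier (fun x : ℝ => (Phi a b x : ℂ)) w‖ ≤ 1 / |w| := by
  rw [Phi_fourier ha hab w hw, Complex.norm_real, Real.norm_eq_abs]
  set t : ℝ := 2 * Real.pi * w with ht
  have ht0 : 0 < |t| := abs_pos.mpr (by positivity)
  have hw0 : 0 < |w| := abs_pos.mpr hw
  have h1 : |Real.sin ((a+b)/2*t)| ≤ 1 := Real.abs_sin_le_one _
  have h2 : |Real.sin ((b-a)/4*t)| ≤ (b-a)/4*|t| := by
    refine Real.abs_sin_le_abs.trans ?_
    rw [abs_mul, abs_of_nonneg (by linarith : 0 ≤ (b-a)/4)]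
  have hba : 0 < b - a := by linarith
  have htw : 6 * |w| ≤ |t| := by
    rw [ht, abs_mul, abs_of_pos (by positivity : 0 < 2 * Real.pi)]
    have := Real.pi_gt_three
    gcongr; linarith
  have h3 : 2 / |t| ≤ 1 / |w| := by
    rw [div_le_div_iff₀ ht0 hw0]; linarith
  refine le_trans ?_ h3
  rw [abs_div, abs_mul, abs_mul, abs_pow, abs_mul, abs_pow, abs_pow, abs_of_pos (by positivity : (0:ℝ) < 8),
    abs_of_pos (by positivity : 0 < (b-a)/2), div_le_iff₀ (by positivity)]
  calc 8 * |Real.sin ((a+b)/2*t)| * |Real.sin ((b-a)/4*t)|^2 ≤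
      8 * 1 * ((b-a)/4*|t|)^2 := by gcongr
    _ = _ := by field_simp; ring

lemma Phi_fourier_bound3 {a b : ℝ} (ha : 0 ≤ a) (hab : a < b) (w : ℝ) (hw : w ≠ 0) :
    ‖FourierTransform.fourier (fun x : ℝ => (Phi a b x : ℂ)) w‖ ≤ 4 / (b-a)^2 * (|w|^3)⁻¹ := by
  rw [Phi_fourier ha hab w hw, Complex.norm_real, Real.norm_eq_abs]
  set t : ℝ := 2 * Real.pi * w with ht
  have ht0 : 0 < |t| := abs_pos.mpr (by positivity)
  have hw0 : 0 < |w| := abs_pos.mpr hw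
  have h1 : |Real.sin ((a+b)/2*t)| ≤ 1 := Real.abs_sin_le_one _
  have h2 : |Real.sin ((b-a)/4*t)| ≤ 1 := Real.abs_sin_le_one _
  have hba : 0 < b - a := by linarith
  have htw : 6 * |w| ≤ |t| := by
    rw [ht, abs_mul, abs_of_pos (by positivity : 0 < 2 * Real.pi)]
    have := Real.pi_gt_three
    gcongr; linarith
  have htw3 : 8 * |w|^3 ≤ |t|^3 := by
    calc 8 * |w|^3 = (2 * |w|)^3 := by ring
      _ ≤ |t|^3 := by gcongr; linarith
  rw [abs_div, abs_mul, abs_mul, abs_pow, abs_mul, abs_pow, abs_pow, abs_of_pos (by positivity : (0:ℝ) < 8),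
    abs_of_pos (by positivity : 0 < (b-a)/2)]
  calc 8 * |Real.sin ((a+b)/2*t)| * |Real.sin ((b-a)/4*t)|^2 / (((b-a)/2)^2 * |t|^3) ≤
      8 * 1 * 1^2 / (((b-a)/2)^2 * (8 * |w|^3)) := by gcongr
    _ = _ := by field_simp; ring

lemma kernel {a b : ℝ} (ha : 0 ≤ a) (hab : a < b) :
    ∃ F : ℝ → ℂ, Integrable F ∧ Integrable (fun w => (1 + |w|) * ‖F w‖) ∧
      ∫ w, ‖F w‖ ≤ 6 + 2 * Real.log ((b + a)/(b - a)) ∧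
      ∀ x : ℝ, ∫ w : ℝ, Complex.exp (2 * Real.pi * w * x * Complex.I) * F w = (Phi a b x : ℂ) := by
  set φ : ℝ → ℂ := fun x => (Phi a b x : ℂ) with hφ
  have hba : 0 < b - a := by linarith
  have hs : 0 < b + a := by linarith
  have hφc : Continuous φ := Complex.continuous_ofReal.comp (Phi_cont a b)
  have hφi : Integrable φ := by
    apply hφc.integrable_of_hasCompactSupport
    apply HasCompactSupport.of_support_subset_isCompact (isCompact_Icc (a := -b) (b := b))
    intro x hx
    by_contra h
    apply hx
    simp only [hφ]
    rw [Phi_zero hab, Complex.ofReal_zero]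
    by_contra h2
    push Not at h2
    exact h ⟨by linarith [neg_abs_le x], by linarith [le_abs_self x]⟩
  set F : ℝ → ℂ := FourierTransform.fourier φ with hF
  have hFc : Continuous F :=
    VectorFourier.fourierIntegral_continuous Real.continuous_fourierChar
      (by exact continuous_inner) hφi
  have B1 : ∀ w : ℝ, w ≠ 0 → ‖F w‖ ≤ a + b := Phi_fourier_bound1 ha hab
  have B2 : ∀ w : ℝ, w ≠ 0 → ‖F w‖ ≤ 1 / |w| := Phi_fourier_bound2 ha hab
  have B3 : ∀ w : ℝ, w ≠ 0 → ‖F w‖ ≤ 4 / (b-a)^2 * (|w|^3)⁻¹ := Phi_fourier_bound3 ha hab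
  have hae : ∀ᵐ w : ℝ, w ≠ 0 := by
    simp [ae_iff]
  have hint1 : Integrable (fun w => (1 + |w|) * ‖F w‖) := by
    apply Integrable.mono' (integrable_inv_one_add_sq.const_mul (4 * (a + b) + 16 / (b-a)^2))
      (by apply Continuous.aestronglyMeasurable; fun_prop)
    filter_upwards [hae] with w hw
    rw [Real.norm_of_nonneg (by positivity), ← div_eq_mul_inv, le_div_iff₀ (by positivity)]
    have hw0 : 0 < |w| := abs_pos.mpr hw
    rw [← sq_abs w]
    rcases le_total (|w|) 1 with h | h
    · have h1 : (1 + |w|) * (1 + |w|^2) ≤ (1 + 1) * (1 + 1^2) := by gcongr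
      have h2 := B1 w hw
      calc (1 + |w|) * ‖F w‖ * (1 + |w|^2) = ((1 + |w|) * (1 + |w|^2)) * ‖F w‖ := by ring
        _ ≤ ((1 + 1) * (1 + 1^2)) * (a + b) := by gcongr
        _ = 4 * (a + b) := by ring
        _ ≤ _ := by
          have : 0 ≤ 16 / (b-a)^2 := by positivity
          linarith
    · have h1 : (1 + |w|) * (1 + |w|^2) ≤ 4 * |w|^3 := by nlinarith [mul_nonneg (sub_nonneg.2 h) (sub_nonneg.2 h), mul_pos hw0 hw0]
      have h2 := B3 w hw
      calc (1 + |w|) * ‖F w‖ * (1 + |w|^2) = ((1 + |w|) * (1 + |w|^2)) * ‖F w‖ := by ring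
        _ ≤ (4 * |w|^3) * (4 / (b-a)^2 * (|w|^3)⁻¹) := by gcongr
        _ = 16 / (b-a)^2 := by field_simp; ring
        _ ≤ _ := by linarith
  have hFi : Integrable F := by
    apply Integrable.mono' hint1 hFc.aestronglyMeasurable
    refine Eventually.of_forall fun w => ?_
    have : 0 ≤ |w| * ‖F w‖ := by positivity
    linarith
  refine ⟨F, hFi, hint1, ?_, ?_⟩
  · have hm : ∀ w : ℝ, ‖F (-w)‖ = ‖F w‖ := by
      intro w
      rcases eq_or_ne w 0 with h | h
      · simp [h]
      · simp only [hF, hφ]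
        rw [Phi_fourier ha hab w h, Phi_fourier ha hab (-w) (neg_ne_zero.mpr h), Complex.norm_real,
          Complex.norm_real]
        have e : ∀ c : ℝ, c * (2 * Real.pi * -w) = -(c * (2 * Real.pi * w)) := by intro c; ring
        have e' : (2 * Real.pi * -w)^3 = -(2 * Real.pi * w)^3 := by ring
        rw [e, e, Real.sin_neg, Real.sin_neg, e']
        congr 1
        rw [neg_sq, mul_neg, mul_neg, neg_mul, neg_div_neg_eq]
    have hsplit : ∫ w, ‖F w‖ = 2 * ∫ w in Set.Ioi (0:ℝ), ‖F w‖ := by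
      rw [← integral_comp_abs (f := fun w => ‖F w‖)]
      congr 1
      ext w
      rcases abs_cases w with h | h
      · rw [h.1]
      · rw [h.1, hm]
    set p : ℝ := 1 / (b + a) with hp
    set q : ℝ := 1 / (b - a) with hq
    have hp0 : 0 < p := by positivity
    have hpq : p ≤ q := by
      apply one_div_le_one_div_of_le hba; linarith
    have hq0 : 0 < q := by positivity
    have hN : Integrable (fun w => ‖F w‖) := hFi.norm
    have s1 : ∫ w in Set.Ioi (0:ℝ), ‖F w‖ = (∫ w in (0:ℝ)..p, ‖F w‖) + ((∫ w in p..q, ‖F w‖)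
        + ∫ w in Set.Ioi q, ‖F w‖) := by
      rw [intervalIntegral.integral_interval_add_Ioi hN.integrableOn hN.integrableOn,
        intervalIntegral.integral_interval_add_Ioi hN.integrableOn hN.integrableOn]
    have i1 : ∫ w in (0:ℝ)..p, ‖F w‖ ≤ 1 := by
      have h := intervalIntegral.integral_mono_on_of_le_Ioo (g := fun _ => a + b) hp0.le hN.intervalIntegrable
        (by simp) (fun w hw => B1 w hw.1.ne')
      refine h.trans ?_
      rw [intervalIntegral.integral_const, smul_eq_mul, sub_zero, hp, add_comm a b,
        one_div_mul_cancel hs.ne']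
    have i2 : ∫ w in p..q, ‖F w‖ ≤ Real.log ((b + a)/(b - a)) := by
      have hg : IntervalIntegrable (fun w : ℝ => 1 / w) volume p q := by
        apply ContinuousOn.intervalIntegrable
        intro w hw
        rw [Set.uIcc_of_le hpq] at hw
        have : w ≠ 0 := (hp0.trans_le hw.1).ne'
        apply ContinuousAt.continuousWithinAt
        fun_prop (disch := assumption)
      have h := intervalIntegral.integral_mono_on_of_le_Ioo (g := fun w => 1 / w) hpq hN.intervalIntegrable
        hg (fun w hw => by
          have h0 : 0 < w := hp0.trans hw.1
          have := B2 w h0.ne'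
          rwa [abs_of_pos h0] at this)
      refine h.trans ?_
      rw [integral_one_div_of_pos hp0 hq0]
      apply le_of_eq
      congr 1
      simp only [hp, hq]
      field_simp
    have i3 : ∫ w in Set.Ioi q, ‖F w‖ ≤ 2 := by
      have hg : IntegrableOn (fun w : ℝ => w ^ (-3:ℝ)) (Set.Ioi q) :=
        integrableOn_Ioi_rpow_of_lt (by norm_num) hq0
      have h := setIntegral_mono_on (hN.integrableOn (s := Set.Ioi q)) (hg.const_mul (4 / (b-a)^2)) measurableSet_Ioi
        (fun w hw => by
          have h0 : 0 < w := hq0.trans hw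
          have := B3 w h0.ne'
          rw [abs_of_pos h0] at this
          have e : w ^ (-3:ℝ) = (w^3)⁻¹ := by
            rw [Real.rpow_neg h0.le]; norm_cast
          rwa [← e] at this)
      refine h.trans ?_
      rw [integral_const_mul, integral_Ioi_rpow_of_lt (by norm_num) hq0]
      have e : q ^ ((-3:ℝ) + 1) = (b-a)^2 := by
        rw [show ((-3:ℝ) + 1) = -2 by norm_num, Real.rpow_neg hq0.le, hq]
        norm_cast
        simp
      rw [e]
      apply le_of_eq
      field_simp
      norm_num
    have hlog : 0 ≤ Real.log ((b + a)/(b - a)) := by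
      apply Real.log_nonneg
      rw [le_div_iff₀ hba]; linarith
    rw [hsplit, s1]
    linarith
  · intro x
    have := congrFun (hφc.fourierInv_fourier_eq hφi hFi) x
    rw [Real.fourierInv_eq'] at this
    simp only [hφ] at this
    rw [← this]
    congr 1
    ext w
    rw [smul_eq_mul]
    congr 2
    simp
    ring

lemma exp_diff (z : ℂ) (hz : 0 < z.re) {α β : ℝ} (h : α ≤ β) :
    ‖Complex.exp (-(α:ℂ) * z) - Complex.exp (-(β:ℂ) * z)‖ ≤
      ‖z‖ / z.re * (Real.exp (-α * z.re) - Real.exp (-β * z.re)) := by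
  have hd : ∀ t : ℝ, HasDerivAt (fun t : ℝ => Complex.exp (-(α:ℂ) * z) - Complex.exp (-(t:ℂ) * z))
      (Complex.exp (-(t:ℂ) * z) * z) t := by
    intro t
    have h0 : HasDerivAt (fun x : ℝ => (x:ℂ)) 1 t := Complex.ofRealCLM.hasDerivAt
    have h1 := ((h0.neg.mul_const z).cexp).const_sub (Complex.exp (-(α:ℂ) * z))
    refine h1.congr_deriv ?_
    simp
  have hB : ∀ t : ℝ, HasDerivAt (fun t : ℝ => ‖z‖ / z.re * (Real.exp (-α * z.re) - Real.exp (-t * z.re)))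
      (‖z‖ * Real.exp (-t * z.re)) t := by
    intro t
    have h1 := ((((hasDerivAt_id t).neg.mul_const z.re).exp).const_sub (Real.exp (-α * z.re))).const_mul (‖z‖ / z.re)
    refine h1.congr_deriv ?_
    simp
    field_simp
  refine image_norm_le_of_norm_deriv_right_le_deriv_boundary (a := α) (b := β)
    (fun t _ => (hd t).continuousAt.continuousWithinAt) (fun t _ => (hd t).hasDerivWithinAt)
    (by simp) hB ?_ ⟨h, le_rfl⟩
  intro t _
  rw [norm_mul, Complex.norm_exp, mul_comm]
  simp

lemma partial_bound (l : ℕ → ℝ) (hl : StrictMono l) (h0 : ∀ n, 0 ≤ l n) (a : ℕ → ℂ) (x0 : ℂ) (B : ℝ)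
    (hB : ∀ K, ‖∑ n ∈ Finset.range K, a n * Complex.exp (-(l n : ℂ) * x0)‖ ≤ B)
    (s : ℂ) (hs : 1 ≤ (s - x0).re) (K : ℕ) :
    ‖∑ n ∈ Finset.range K, a n * Complex.exp (-(l n : ℂ) * s)‖ ≤ B * (1 + ‖s - x0‖) := by
  set z := s - x0 with hz
  set A : ℕ → ℂ := fun K => ∑ n ∈ Finset.range K, a n * Complex.exp (-(l n : ℂ) * x0) with hA
  have hB0 : 0 ≤ B := (norm_nonneg _).trans (hB 0)
  have abel : ∀ K, ∑ n ∈ Finset.range K, a n * Complex.exp (-(l n : ℂ) * s) =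
      A K * Complex.exp (-(l K : ℂ) * z) + ∑ n ∈ Finset.range K,
        A (n+1) * (Complex.exp (-(l n : ℂ) * z) - Complex.exp (-(l (n+1) : ℂ) * z)) := by
    intro K
    induction K with
    | zero => simp [hA]
    | succ K ih =>
      rw [Finset.sum_range_succ, ih, Finset.sum_range_succ]
      have h1 : A (K+1) = A K + a K * Complex.exp (-(l K : ℂ) * x0) := by
        simp only [hA]; rw [Finset.sum_range_succ]
      have h2 : Complex.exp (-(l K : ℂ) * s) = Complex.exp (-(l K : ℂ) * x0) * Complex.exp (-(l K : ℂ) * z) := by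
        rw [← Complex.exp_add, hz]; congr 1; ring
      rw [h1, h2]
      ring
  rw [abel]
  have hzr : 0 < z.re := by linarith
  have b1 : ‖A K * Complex.exp (-(l K : ℂ) * z)‖ ≤ B * Real.exp (-l K * z.re) := by
    rw [norm_mul, Complex.norm_exp]
    have : (-(l K : ℂ) * z).re = -l K * z.re := by simp
    rw [this]
    gcongr
    exact hB K
  have b2 : ‖∑ n ∈ Finset.range K,
        A (n+1) * (Complex.exp (-(l n : ℂ) * z) - Complex.exp (-(l (n+1) : ℂ) * z))‖ ≤
      B * (‖z‖ / z.re * (Real.exp (-l 0 * z.re) - Real.exp (-l K * z.re))) := by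
    refine (norm_sum_le _ _).trans ?_
    rw [← Finset.sum_range_sub' (fun n => Real.exp (-l n * z.re)), Finset.mul_sum, Finset.mul_sum]
    apply Finset.sum_le_sum
    intro n _
    rw [norm_mul]
    gcongr
    · exact hB _
    · exact exp_diff z hzr (hl (Nat.lt_succ_self n)).le
  have e1 : ∀ n, Real.exp (-l n * z.re) ≤ 1 := by
    intro n
    apply Real.exp_le_one_iff.mpr
    have := mul_nonneg (h0 n) hzr.le
    linarith
  have e2 : ‖z‖ / z.re ≤ ‖z‖ := div_le_self (norm_nonneg _) hs
  have e3 : ‖z‖ / z.re * (Real.exp (-l 0 * z.re) - Real.exp (-l K * z.re)) ≤ ‖z‖ := by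
    have h1 : Real.exp (-l 0 * z.re) - Real.exp (-l K * z.re) ≤ 1 := by
      linarith [e1 0, Real.exp_pos (-l K * z.re)]
    calc _ ≤ ‖z‖ / z.re * 1 := by gcongr
      _ ≤ _ := by linarith
  calc _ ≤ _ := norm_add_le _ _
    _ ≤ B * 1 + B * ‖z‖ := by
      refine add_le_add (b1.trans ?_) (b2.trans ?_) <;> gcongr
      exact e1 K
    _ = _ := by ring

/-- differentiability of the smoothed function -/
lemma smooth_diff (f F : _) (hf : DifferentiableOn ℂ f {s : ℂ | 0 < s.re}) (Mb : ℝ)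
    (hb : ∀ s : ℂ, 0 < s.re → ‖f s‖ ≤ Mb) (hF : Integrable (F : ℝ → ℂ)) :
    DifferentiableOn ℂ (fun s : ℂ => ∫ w : ℝ, f (s - 2 * Real.pi * w * Complex.I) * F w)
      {s : ℂ | 0 < s.re} := by
  have hre : ∀ (s : ℂ) (w : ℝ), (s - 2 * Real.pi * w * Complex.I).re = s.re := by
    intro s w; simp
  have hopen : IsOpen {s : ℂ | 0 < s.re} := isOpen_lt continuous_const Complex.continuous_re
  have hmeas : ∀ s : ℂ, 0 < s.re →
      AEStronglyMeasurable (fun w : ℝ => f (s - 2 * Real.pi * w * Complex.I) * F w) := by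
    intro s hs
    apply AEStronglyMeasurable.mul _ hF.1
    apply Continuous.aestronglyMeasurable
    apply hf.continuousOn.comp_continuous (by fun_prop)
    intro w
    simp only [Set.mem_ofPred_eq]; rw [hre]; exact hs
  intro s0 hs0
  have hs0' : 0 < s0.re := hs0
  set r := s0.re / 2 with hr
  have hr0 : 0 < r := by positivity
  have hnear : ∀ x y : ℂ, dist x y ≤ r → y.re - r ≤ x.re := by
    intro x y hxy
    rw [dist_eq_norm] at hxy
    have := (abs_le.mp ((Complex.abs_re_le_norm (x - y)).trans hxy)).1
    rw [Complex.sub_re] at this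
    linarith
  refine DifferentiableAt.differentiableWithinAt ?_
  refine (hasDerivAt_integral_of_dominated_loc_of_deriv_le (μ := volume)
    (F' := fun s w => deriv f (s - 2 * Real.pi * w * Complex.I) * F w)
    (bound := fun w => Mb / (r/2) * ‖F w‖) (s := Metric.ball s0 r) (Metric.ball_mem_nhds _ hr0) ?_ ?_ ?_ ?_ ?_ ?_).2.differentiableAt
  · filter_upwards [hopen.mem_nhds hs0] with s hs using hmeas s hs
  · apply Integrable.mono' (hF.norm.const_mul Mb) (hmeas s0 hs0)
    refine Eventually.of_forall fun w => ?_
    rw [norm_mul]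
    gcongr
    apply hb; rw [hre]; exact hs0'
  · apply AEStronglyMeasurable.mul _ hF.1
    apply Measurable.aestronglyMeasurable
    apply (measurable_deriv f).comp
    fun_prop
  · refine Eventually.of_forall fun w s hs => ?_
    rw [norm_mul]
    gcongr
    have hs' := hnear s s0 (Metric.mem_ball.mp hs).le
    have hball : ∀ y ∈ Metric.closedBall (s - 2 * Real.pi * w * Complex.I) (r/2), 0 < y.re := by
      intro y hy
      rw [Metric.mem_closedBall, dist_eq_norm] at hy
      have := (abs_le.mp ((Complex.abs_re_le_norm _).trans hy)).1
      rw [Complex.sub_re, hre] at this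
      linarith
    apply Complex.norm_deriv_le_of_forall_mem_sphere_norm_le (by positivity)
    · apply DifferentiableOn.diffContOnCl_ball (U := {s : ℂ | 0 < s.re}) hf
      exact hball
    · intro y hy
      exact hb y (hball y (Metric.sphere_subset_closedBall hy))
  · exact hF.norm.const_mul _
  · refine Eventually.of_forall fun w s hs => ?_
    have hs' := hnear s s0 (Metric.mem_ball.mp hs).le
    have hd : HasDerivAt f (deriv f (s - 2 * Real.pi * w * Complex.I)) (s - 2 * Real.pi * w * Complex.I) := by
      apply (hf.differentiableAt (hopen.mem_nhds _)).hasDerivAt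
      simp only [Set.mem_ofPred_eq]; rw [hre]; linarith
    exact (hd.comp_sub_const _ _).mul_const _

lemma smooth_sum (l : ℕ → ℝ) (hl : StrictMono l) (h0 : ∀ n, 0 ≤ l n)
    (a : ℕ → ℂ) (σ₀ : ℝ) (f : ℂ → ℂ)
    (hconv : ∀ s : ℂ, σ₀ < s.re →
        Tendsto (fun K : ℕ => ∑ n ∈ Finset.range K, a n * Complex.exp (-(l n : ℂ) * s))
          atTop (nhds (f s)))
    (hf : DifferentiableOn ℂ f {s : ℂ | 0 < s.re}) (Mb : ℝ)
    (hb : ∀ s : ℂ, 0 < s.re → ‖f s‖ ≤ Mb)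
    (F : ℝ → ℂ) (hF : Integrable F) (hF1 : Integrable (fun w => (1 + |w|) * ‖F w‖))
    (Φ : ℝ → ℂ) (hΦ : ∀ x : ℝ, ∫ w : ℝ, Complex.exp (2 * Real.pi * w * x * Complex.I) * F w = Φ x)
    (K₀ : ℕ) (hK : ∀ n, K₀ ≤ n → Φ (l n) = 0) (s : ℂ) (hs : 0 < s.re) :
    ‖∑ n ∈ Finset.range K₀, Φ (l n) * (a n * Complex.exp (-(l n : ℂ) * s))‖ ≤ Mb * ∫ w, ‖F w‖ := by
  have hre : ∀ (s : ℂ) (w : ℝ), (s - 2 * Real.pi * w * Complex.I).re = s.re := by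
    intro s w; simp
  have hopen : IsOpen {s : ℂ | 0 < s.re} := isOpen_lt continuous_const Complex.continuous_re
  set x0 : ℝ := max σ₀ 0 + 1 with hx0
  have hx0' : σ₀ < x0 := by have := le_max_left σ₀ 0; linarith
  have hx0'' : 0 < x0 := by have := le_max_right σ₀ 0; linarith
  obtain ⟨B, hB⟩ : ∃ B, ∀ K, ‖∑ n ∈ Finset.range K, a n * Complex.exp (-(l n : ℂ) * (x0:ℂ))‖ ≤ B := by
    obtain ⟨B, hB⟩ := (hconv x0 (by simpa using hx0')).norm.bddAbove_range
    exact ⟨B, fun K => hB ⟨K, rfl⟩⟩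
  have hB0 : 0 ≤ B := (norm_nonneg _).trans (hB 0)
  -- the identity far to the right
  have far : ∀ s : ℂ, x0 + 1 < s.re →
      ∫ w : ℝ, f (s - 2 * Real.pi * w * Complex.I) * F w =
        ∑ n ∈ Finset.range K₀, Φ (l n) * (a n * Complex.exp (-(l n : ℂ) * s)) := by
    intro s hs
    have term_int : ∀ n : ℕ, Integrable (fun w : ℝ =>
        a n * Complex.exp (-(l n : ℂ) * (s - 2 * Real.pi * w * Complex.I)) * F w) := by
      intro n
      apply Integrable.mono' (hF.norm.const_mul (‖a n‖ * Real.exp (-l n * s.re)))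
      · apply AEStronglyMeasurable.mul _ hF.1
        apply Continuous.aestronglyMeasurable
        fun_prop
      · refine Eventually.of_forall fun w => ?_
        rw [norm_mul, norm_mul, Complex.norm_exp]
        simp
    have lim : Tendsto (fun K : ℕ => ∫ w : ℝ, (∑ n ∈ Finset.range K,
        a n * Complex.exp (-(l n : ℂ) * (s - 2 * Real.pi * w * Complex.I))) * F w) atTop
        (nhds (∫ w : ℝ, f (s - 2 * Real.pi * w * Complex.I) * F w)) := by
      apply tendsto_integral_of_dominated_convergence
        (bound := fun w => (B * (1 + ‖s - x0‖ + 2 * Real.pi)) * ((1 + |w|) * ‖F w‖))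
      · intro K
        apply AEStronglyMeasurable.mul _ hF.1
        apply Continuous.aestronglyMeasurable
        fun_prop
      · exact hF1.const_mul _
      · intro K
        refine Eventually.of_forall fun w => ?_
        rw [norm_mul, ← mul_assoc]
        gcongr
        have h1 := partial_bound l hl h0 a x0 B hB (s - 2 * Real.pi * w * Complex.I)
          (by rw [Complex.sub_re, hre, Complex.ofReal_re]; linarith) K
        refine h1.trans ?_
        rw [mul_assoc B]
        gcongr
        have h2 : ‖s - 2 * Real.pi * w * Complex.I - x0‖ ≤ ‖s - x0‖ + 2 * Real.pi * |w| := by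
          have e : s - 2 * Real.pi * w * Complex.I - x0 = (s - x0) - 2 * Real.pi * w * Complex.I := by ring
          rw [e]
          refine (norm_sub_le _ _).trans ?_
          apply le_of_eq
          simp [abs_of_pos Real.pi_pos]
        have h3 : 0 ≤ ‖s - x0‖ * |w| := by positivity
        have h4 := abs_nonneg w
        have h5 := Real.pi_pos
        nlinarith
      · refine Eventually.of_forall fun w => ?_
        apply Tendsto.mul_const
        apply hconv
        rw [hre]; linarith
    have eqK : ∀ K : ℕ, ∫ w : ℝ, (∑ n ∈ Finset.range K,
        a n * Complex.exp (-(l n : ℂ) * (s - 2 * Real.pi * w * Complex.I))) * F w =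
        ∑ n ∈ Finset.range K, Φ (l n) * (a n * Complex.exp (-(l n : ℂ) * s)) := by
      intro K
      simp_rw [Finset.sum_mul]
      rw [integral_finsetSum _ (fun n _ => term_int n)]
      apply Finset.sum_congr rfl
      intro n _
      rw [← hΦ, ← integral_mul_const]
      congr 1
      ext w
      have : -(l n : ℂ) * (s - 2 * Real.pi * w * Complex.I) =
        2 * Real.pi * w * (l n) * Complex.I + -(l n : ℂ) * s := by ring
      rw [this, Complex.exp_add]
      ring
    have lim2 : Tendsto (fun K : ℕ => ∫ w : ℝ, (∑ n ∈ Finset.range K,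
        a n * Complex.exp (-(l n : ℂ) * (s - 2 * Real.pi * w * Complex.I))) * F w) atTop
        (nhds (∑ n ∈ Finset.range K₀, Φ (l n) * (a n * Complex.exp (-(l n : ℂ) * s)))) := by
      apply tendsto_const_nhds.congr'
      filter_upwards [eventually_ge_atTop K₀] with K hKK
      rw [eqK]
      apply Finset.sum_subset (Finset.range_mono hKK)
      intro n _ hn
      rw [hK n (by simpa using hn), zero_mul]
    exact tendsto_nhds_unique lim lim2
  have hd1 := (smooth_diff f F hf Mb hb hF).analyticOnNhd hopen
  have hd2 : DifferentiableOn ℂ (fun s : ℂ => ∑ n ∈ Finset.range K₀, Φ (l n) * (a n * Complex.exp (-(l n : ℂ) * s)))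
      {s : ℂ | 0 < s.re} := by
    apply Differentiable.differentiableOn
    fun_prop
  have heq := hd1.eqOn_of_preconnected_of_eventuallyEq (hd2.analyticOnNhd hopen)
    ((convex_halfSpace_re_gt 0).isPreconnected) (z₀ := ((x0 + 2 : ℝ) : ℂ))
    (by rw [Set.mem_ofPred_eq, Complex.ofReal_re]; linarith) (by
      have : IsOpen {s : ℂ | x0 + 1 < s.re} := isOpen_lt continuous_const Complex.continuous_re
      filter_upwards [this.mem_nhds (show x0 + 1 < (((x0 + 2 : ℝ) : ℂ)).re by rw [Complex.ofReal_re]; linarith)] with s hs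
      exact far s hs)
  have hh := heq hs
  simp only at hh
  rw [← hh]
  refine (norm_integral_le_integral_norm _).trans ?_
  rw [← integral_const_mul]
  apply integral_mono_of_nonneg (Eventually.of_forall fun w => norm_nonneg _) (hF.norm.const_mul Mb)
  refine Eventually.of_forall fun w => ?_
  simp only [norm_mul]
  gcongr
  apply hb
  rw [hre]; exact hs

lemma coeff_bound (l : ℕ → ℝ) (hl : StrictMono l) (h0 : ∀ n, 0 ≤ l n)
    (a : ℕ → ℂ) (σ₀ : ℝ) (f : ℂ → ℂ)
    (hconv : ∀ s : ℂ, σ₀ < s.re →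
        Tendsto (fun K : ℕ => ∑ n ∈ Finset.range K, a n * Complex.exp (-(l n : ℂ) * s))
          atTop (nhds (f s)))
    (hf : DifferentiableOn ℂ f {s : ℂ | 0 < s.re}) (Mb : ℝ)
    (hb : ∀ s : ℂ, 0 < s.re → ‖f s‖ ≤ Mb) (k : ℕ) (s : ℂ) (hs : 0 < s.re) :
    ‖a k * Complex.exp (-(l k : ℂ) * s)‖ ≤ Mb * 6 := by
  have hMb : 0 ≤ Mb := (norm_nonneg _).trans (hb s hs)
  -- a positive gap around `l k`
  obtain ⟨b, hb0, hgap⟩ : ∃ b > 0, ∀ n, n ≠ k → b ≤ |l n - l k| := by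
    rcases Nat.eq_zero_or_pos k with h | h
    · refine ⟨l (k+1) - l k, sub_pos.mpr (hl (Nat.lt_succ_self k)), fun n hn => ?_⟩
      have : l (k+1) ≤ l n := hl.monotone (by omega)
      exact le_trans (by linarith) (le_abs_self _)
    · refine ⟨min (l (k+1) - l k) (l k - l (k-1)), lt_min (sub_pos.mpr (hl (Nat.lt_succ_self k)))
        (sub_pos.mpr (hl (by omega))), fun n hn => ?_⟩
      rcases lt_or_gt_of_ne hn with h1 | h1
      · have : l n ≤ l (k-1) := hl.monotone (by omega)
        exact (min_le_right _ _).trans (le_trans (by linarith) (neg_le_abs _))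
      · have : l (k+1) ≤ l n := hl.monotone (by omega)
        exact (min_le_left _ _).trans (le_trans (by linarith) (le_abs_self _))
  obtain ⟨F, hF, hF1, hFb, hFΦ⟩ := kernel le_rfl hb0
  have hnorm : ∀ w : ℝ, ‖Complex.exp (-(2 * Real.pi * w * l k * Complex.I))‖ = 1 := by
    intro w
    rw [Complex.norm_exp]; simp
  have hmul : ∀ w : ℝ, ‖Complex.exp (-(2 * Real.pi * w * l k * Complex.I)) * F w‖ = ‖F w‖ := by
    intro w
    rw [norm_mul, hnorm, one_mul]
  have main := smooth_sum l hl h0 a σ₀ f hconv hf Mb hb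
    (fun w => Complex.exp (-(2 * Real.pi * w * l k * Complex.I)) * F w)
    (by
      apply Integrable.mono' hF.norm
      · apply AEStronglyMeasurable.mul _ hF.1
        apply Continuous.aestronglyMeasurable
        fun_prop
      · exact Eventually.of_forall fun w => (hmul w).le)
    (by simp_rw [hmul]; exact hF1)
    (fun x => (Phi 0 b (x - l k) : ℂ))
    (by
      intro x
      rw [← hFΦ]
      congr 1
      ext w
      rw [← mul_assoc, ← Complex.exp_add]
      congr 2
      push_cast
      ring)
    (k+1) (fun n hn => by
      rw [Phi_zero hb0 (hgap n (by omega)), Complex.ofReal_zero]) s hs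
  rw [Finset.sum_range_succ, Finset.sum_eq_zero, zero_add] at main
  · rw [sub_self, Phi_one hb0 (by simp), Complex.ofReal_one, one_mul] at main
    refine main.trans ?_
    gcongr
    simp_rw [hmul]
    refine hFb.trans ?_
    simp [hb0.ne']
  · intro n hn
    rw [Phi_zero hb0 (hgap n (by simp at hn; omega)), Complex.ofReal_zero, zero_mul]


end Helpers

/-- There is an absolute constant `C > 0` such that for every frequency `λ` and every
somewhere-convergent `λ`-Dirichlet series with a bounded holomorphic extension `f` to the
right half-plane, the partial sums satisfy
`sup_{Re s>0} |∑_{n≤N} aₙ e^{−λₙ s}| ≤ C(log((λ_M+λ_N)/(λ_M−λ_N)) + (M−N−1) + 1)‖f‖_∞`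
for all indices `M > N`. -/
theorem partial_sum_bound :
    ∃ C > (0 : ℝ), ∀ (l : ℕ → ℝ), StrictMono l → (∀ n, 0 ≤ l n) →
      Tendsto l atTop atTop →
      ∀ (a : ℕ → ℂ) (σ₀ : ℝ) (f : ℂ → ℂ),
      (∀ s : ℂ, σ₀ < s.re →
        Tendsto (fun K : ℕ => ∑ n ∈ Finset.range K, a n * Complex.exp (-(l n : ℂ) * s))
          atTop (nhds (f s))) →
      DifferentiableOn ℂ f {s : ℂ | 0 < s.re} →
      ∀ Mb : ℝ, (∀ s : ℂ, 0 < s.re → ‖f s‖ ≤ Mb) →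
      ∀ N M : ℕ, N < M →
      ∀ s : ℂ, 0 < s.re →
        ‖∑ n ∈ Finset.range (N + 1), a n * Complex.exp (-(l n : ℂ) * s)‖ ≤
          C * (Real.log ((l M + l N) / (l M - l N)) + ((M : ℝ) - (N : ℝ) - 1) + 1) * Mb := by
  refine ⟨6, by norm_num, ?_⟩
  intro l hl h0 _ a σ₀ f hconv hf Mb hb N M hNM s hs
  have hMb : 0 ≤ Mb := (norm_nonneg _).trans (hb s hs)
  have hlt : l N < l M := hl hNM
  obtain ⟨F, hF, hF1, hFb, hFΦ⟩ := kernel (h0 N) hlt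
  have main := smooth_sum l hl h0 a σ₀ f hconv hf Mb hb F hF hF1 (fun x => (Phi (l N) (l M) x : ℂ))
    hFΦ M (fun n hn => by
      rw [Phi_zero hlt, Complex.ofReal_zero]
      rw [abs_of_nonneg (h0 n)]; exact hl.monotone hn) s hs
  rw [← Finset.sum_range_add_sum_Ico _ (show N + 1 ≤ M from hNM)] at main
  have e1 : ∑ n ∈ Finset.range (N + 1), (Phi (l N) (l M) (l n) : ℂ) * (a n * Complex.exp (-(l n : ℂ) * s))
      = ∑ n ∈ Finset.range (N + 1), a n * Complex.exp (-(l n : ℂ) * s) := by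
    apply Finset.sum_congr rfl
    intro n hn
    rw [Phi_one hlt, Complex.ofReal_one, one_mul]
    rw [abs_of_nonneg (h0 n)]
    exact hl.monotone (by simp at hn; omega)
  rw [e1] at main
  have e2 : ‖∑ n ∈ Finset.Ico (N + 1) M, (Phi (l N) (l M) (l n) : ℂ) * (a n * Complex.exp (-(l n : ℂ) * s))‖
      ≤ ((M:ℝ) - N - 1) * (Mb * 6) := by
    refine (norm_sum_le_of_le (f := fun n => (Phi (l N) (l M) (l n) : ℂ) * (a n * Complex.exp (-(l n : ℂ) * s))) _ (n := fun _ => Mb * 6) ?_).trans ?_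
    · intro n _
      rw [norm_mul, Complex.norm_real, Real.norm_eq_abs]
      calc _ ≤ 1 * (Mb * 6) := mul_le_mul (Phi_abs hlt)
            (coeff_bound l hl h0 a σ₀ f hconv hf Mb hb n s hs) (norm_nonneg _) zero_le_one
        _ = _ := one_mul _
    · rw [Finset.sum_const, Nat.card_Ico, nsmul_eq_mul, Nat.cast_sub (show N + 1 ≤ M from hNM)]
      apply le_of_eq
      push_cast
      ring
  have hlog : 0 ≤ Real.log ((l M + l N) / (l M - l N)) := by
    apply Real.log_nonneg
    rw [le_div_iff₀ (by linarith)]; linarith [h0 N]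
  have e3 : Mb * ∫ w, ‖F w‖ ≤ Mb * (6 + 2 * Real.log ((l M + l N) / (l M - l N))) := by gcongr
  have e4 := mul_nonneg hMb hlog
  calc _ ≤ _ := norm_le_add_norm_add _ _
    _ ≤ Mb * (6 + 2 * Real.log ((l M + l N) / (l M - l N))) + ((M:ℝ) - N - 1) * (Mb * 6) :=
      add_le_add (main.trans e3) e2
    _ ≤ _ := by nlinarith
end

section
/- Let λ be a frequency satisfying (NC). Then λ satisfies Bohr's theorem: if (a_n) are complex coefficients such that the λ-Dirichlet series D = ∑_{n≥1} a_n e^{−λ_n s} converges for all s with Re s > σ₀, and f is a bounded holomorphic function on C_0 = {Re s > 0} with f(s) = ∑_{n≥1} a_n e^{−λ_n s} for Re s > σ₀, then for every ε > 0 the partial sums ∑_{n=1}^N a_n e^{−λ_n s} converge uniformly to f on the half-plane C_ε = {Re s > ε} as N → ∞. -/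
open Filter
theorem abel_identity (b : ℕ → ℂ) (c : ℕ → ℝ) (N : ℕ) :
    ∑ i ∈ Finset.range N, (c i : ℂ) * b i
      = (c N : ℂ) * ∑ i ∈ Finset.range N, b i
        + ∑ i ∈ Finset.range N, ((c i : ℂ) - c (i+1)) * ∑ j ∈ Finset.range (i+1), b j := by
  induction N with
  | zero => simp
  | succ n ih =>
    rw [Finset.sum_range_succ, ih, Finset.sum_range_succ (fun i => ((c i : ℂ) - c (i+1)) * ∑ j ∈ Finset.range (i+1), b j)]
    rw [Finset.sum_range_succ b n]
    ring

theorem abel_bound (b : ℕ → ℂ) (c : ℕ → ℝ) (hc : Antitone c) (hc0 : ∀ n, 0 ≤ c n) (B : ℝ)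
    (hB : ∀ n, ‖∑ i ∈ Finset.range n, b i‖ ≤ B) (N : ℕ) :
    ‖∑ i ∈ Finset.range N, (c i : ℂ) * b i‖ ≤ B * c 0 := by
  rw [abel_identity]
  have h1 : ‖(c N : ℂ) * ∑ i ∈ Finset.range N, b i‖ ≤ c N * B := by
    rw [norm_mul, Complex.norm_real, Real.norm_of_nonneg (hc0 N)]
    exact mul_le_mul_of_nonneg_left (hB N) (hc0 N)
  have h2 : ‖∑ i ∈ Finset.range N, ((c i : ℂ) - c (i+1)) * ∑ j ∈ Finset.range (i+1), b j‖
      ≤ ∑ i ∈ Finset.range N, (c i - c (i+1)) * B := by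
    refine norm_sum_le_of_le _ fun i _ => ?_
    have : 0 ≤ c i - c (i+1) := sub_nonneg.2 (hc (Nat.le_succ i))
    rw [norm_mul, ← Complex.ofReal_sub, Complex.norm_real, Real.norm_of_nonneg this]
    exact mul_le_mul_of_nonneg_left (hB _) this
  rw [← Finset.sum_mul, Finset.sum_range_sub'] at h2
  calc _ ≤ _ := norm_add_le _ _
    _ ≤ _ := by linarith

/-- final step -/
theorem bohr_final (l : ℕ → ℝ) (hmono : StrictMono l)
    (htend : Tendsto l atTop atTop)
    (a : ℕ → ℂ) (σ₀ : ℝ) (f : ℂ → ℂ)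
    (hconv : ∀ s : ℂ, σ₀ < s.re →
      Tendsto (fun N : ℕ => ∑ n ∈ Finset.range N, a n * Complex.exp (-(l n : ℂ) * s))
        atTop (nhds (f s)))
    (hf : DifferentiableOn ℂ f {s : ℂ | 0 < s.re})
    (δ : ℝ) (hδ : 0 < δ) (C : ℝ) (hC : 0 ≤ C)
    (hb : ∀ s : ℂ, 0 < s.re → ∀ n, ‖∑ k ∈ Finset.range (n+1), a k * Complex.exp (-(l k : ℂ) * s)‖
        ≤ C * Real.exp (δ * l n)) :
      TendstoUniformlyOn
        (fun (N : ℕ) (s : ℂ) => ∑ n ∈ Finset.range N, a n * Complex.exp (-(l n : ℂ) * s))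
        f atTop {s : ℂ | 2 * δ < s.re} := by
  set p : ℕ → ℝ := fun n => Real.exp (-δ * l n) with hp
  have hp0 : ∀ n, 0 < p n := fun n => Real.exp_pos _
  have hpanti : Antitone p := by
    intro i j hij
    apply Real.exp_le_exp.2
    have := hmono.monotone hij
    nlinarith
  have hptend : Tendsto p atTop (nhds 0) := by
    apply Real.tendsto_exp_atBot.comp
    exact htend.const_mul_atTop_of_neg (by linarith)
  have hpe : ∀ n, Real.exp (δ * l n) = (p n)⁻¹ := fun n => by
    rw [hp]; simp only; rw [← Real.exp_neg]; ring_nf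
  set c : ℕ → ℝ := fun n => p n ^ 2 with hcdef
  set b : ℂ → ℕ → ℂ := fun s n => a n * Complex.exp (-(l n : ℂ) * (s - 2 * δ)) with hbdef
  have hcb : ∀ s n, a n * Complex.exp (-(l n : ℂ) * s) = (c n : ℂ) * b s n := by
    intro s n
    simp only [hcdef, hbdef, hp]
    rw [Complex.ofReal_pow, Complex.ofReal_exp, ← Complex.exp_nat_mul, mul_left_comm, ← Complex.exp_add]
    congr 2
    push_cast; ring
  have hbb : ∀ s ∈ {s : ℂ | 2 * δ < s.re}, ∀ n, ‖∑ k ∈ Finset.range (n+1), b s k‖ ≤ C * (p n)⁻¹ := by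
    intro s hs n
    rw [← hpe]
    apply hb
    have : 2 * δ < s.re := hs
    simp; linarith
  set D : ℂ → ℂ := fun s => ∑' i, ((c i : ℂ) - c (i+1)) * ∑ j ∈ Finset.range (i+1), b s j
  have hsum : Summable (fun i => 2 * C * (p i - p (i+1))) := by
    apply Summable.mul_left
    have : HasSum (fun i => p i - p (i+1)) (p 0 - 0) := by
      rw [hasSum_iff_tendsto_nat_of_nonneg]
      · simp_rw [Finset.sum_range_sub']
        exact hptend.const_sub _
      · intro i; exact sub_nonneg.2 (hpanti (Nat.le_succ i))
    exact this.summable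
  have hU2 := tendstoUniformlyOn_tsum_nat (f := fun i s => ((c i : ℂ) - c (i+1)) * ∑ j ∈ Finset.range (i+1), b s j)
    hsum (s := {s : ℂ | 2 * δ < s.re}) (by
    intro i s hs
    have h0 : p (i+1) ≤ p i := hpanti (Nat.le_succ i)
    have : 0 ≤ c i - c (i+1) := by
      simp only [hcdef]; have := hp0 (i+1); nlinarith
    rw [norm_mul, ← Complex.ofReal_sub, Complex.norm_real, Real.norm_of_nonneg this]
    calc _ ≤ (c i - c (i+1)) * (C * (p i)⁻¹) := mul_le_mul_of_nonneg_left (hbb s hs i) this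
      _ = C * (p i - p (i+1)) * ((p i + p (i+1)) * (p i)⁻¹) := by simp only [hcdef]; ring
      _ ≤ C * (p i - p (i+1)) * 2 := by
        apply mul_le_mul_of_nonneg_left _ (mul_nonneg hC (by linarith))
        rw [mul_inv_le_iff₀ (hp0 i)]; linarith
      _ = _ := by ring)
  have hU1 : TendstoUniformlyOn (fun (N : ℕ) (s : ℂ) => (c N : ℂ) * ∑ i ∈ Finset.range N, b s i)
      (fun _ => 0) atTop {s : ℂ | 2 * δ < s.re} := by
    rw [Metric.tendstoUniformlyOn_iff]
    intro e he
    have : Tendsto (fun N => C * p N) atTop (nhds 0) := by simpa using hptend.const_mul C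
    filter_upwards [this.eventually (gt_mem_nhds he), eventually_gt_atTop 0] with N hN hN0 s hs
    obtain ⟨n, rfl⟩ : ∃ n, N = n + 1 := ⟨N-1, by omega⟩
    rw [dist_zero_left, norm_mul, Complex.norm_real, Real.norm_of_nonneg (sq_nonneg _)]
    refine lt_of_le_of_lt ?_ hN
    have h0 : p (n+1) ≤ p n := hpanti (Nat.le_succ n)
    calc c (n+1) * _ ≤ c (n+1) * (C * (p n)⁻¹) := mul_le_mul_of_nonneg_left (hbb s hs n) (sq_nonneg _)
      _ ≤ c (n+1) * (C * (p (n+1))⁻¹) := by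
        have := hp0 (n+1)
        gcongr
      _ = _ := by
        simp only [hcdef]; have := (hp0 (n+1)).ne'; field_simp
  have hU : TendstoUniformlyOn
        (fun (N : ℕ) (s : ℂ) => ∑ n ∈ Finset.range N, a n * Complex.exp (-(l n : ℂ) * s))
        D atTop {s : ℂ | 2 * δ < s.re} := by
    have := hU1.add hU2
    refine (this.congr_right ?_).congr ?_
    · intro s hs; simp [D]
    · refine Eventually.of_forall fun N s hs => ?_
      simp only [Pi.add_apply, hcb]
      rw [abel_identity]
  refine hU.congr_right ?_
  have hopen : IsOpen {s : ℂ | 2 * δ < s.re} := isOpen_lt continuous_const Complex.continuous_re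
  have hD : DifferentiableOn ℂ D {s : ℂ | 2 * δ < s.re} := by
    refine hU.tendstoLocallyUniformlyOn.differentiableOn (Eventually.of_forall fun N => ?_) hopen
    exact Differentiable.differentiableOn (by fun_prop)
  have hf' : DifferentiableOn ℂ f {s : ℂ | 2 * δ < s.re} :=
    hf.mono fun s hs => by
      have : 2 * δ < s.re := hs
      show 0 < s.re
      linarith
  set z : ℂ := ((max σ₀ (2*δ) + 1 : ℝ) : ℂ)
  have hz1 : σ₀ < z.re := by simp [z]; linarith [le_max_left σ₀ (2*δ)]
  have hz2 : 2*δ < z.re := by simp [z]; linarith [le_max_right σ₀ (2*δ)]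
  refine (hD.analyticOnNhd hopen).eqOn_of_preconnected_of_eventuallyEq (hf'.analyticOnNhd hopen)
    (convex_halfSpace_re_gt _).isPreconnected hz2 ?_
  filter_upwards [(isOpen_lt continuous_const Complex.continuous_re).mem_nhds hz1, hopen.mem_nhds hz2] with s hs hs2
  exact tendsto_nhds_unique (hU.tendsto_at hs2) (hconv s hs)

theorem norm_line (c t : ℝ) : ‖((c : ℂ) + t * Complex.I)‖ ^ 2 = c ^ 2 + t ^ 2 := by
  rw [← Complex.normSq_eq_norm_sq, Complex.normSq_add_mul_I]

theorem integrable_inv_sq_add (c : ℝ) (hc : 0 < c) :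
    MeasureTheory.Integrable (fun t : ℝ => (c ^ 2 + t ^ 2)⁻¹) := by
  have h := (integrable_inv_one_add_sq.comp_div hc.ne').const_mul (c ^ 2)⁻¹
  refine h.congr (Eventually.of_forall fun t => ?_)
  simp only
  rw [← mul_inv]
  congr 1
  field_simp

theorem line_ne (c t : ℝ) (hc : 0 < c) : ((c : ℂ) + t * Complex.I) ≠ 0 := by
  intro h
  have := congrArg Complex.re h
  simp at this
  exact hc.ne' this

theorem integrable_line (c : ℝ) (hc : 0 < c) (H : ℝ → ℂ) (hH : Continuous H) (B : ℝ)
    (hB : ∀ t, ‖H t‖ ≤ B) :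
    MeasureTheory.Integrable (fun t : ℝ => H t / ((c : ℂ) + t * Complex.I) ^ 2) := by
  refine ((integrable_inv_sq_add c hc).const_mul B).mono' ?_ (Eventually.of_forall fun t => ?_)
  · apply Continuous.aestronglyMeasurable
    apply hH.div (by fun_prop)
    intro t
    exact pow_ne_zero _ (line_ne c t hc)
  · rw [norm_div, norm_pow, norm_line, div_eq_mul_inv]
    exact mul_le_mul_of_nonneg_right (hB t) (by positivity)

theorem perron_basic (c : ℝ) (hc : 0 < c) (y : ℝ) :
    ∫ t : ℝ, Complex.exp (y * ((c : ℂ) + t * Complex.I)) / ((c : ℂ) + t * Complex.I) ^ 2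
      = 2 * Real.pi * ((max 0 y : ℝ) : ℂ) := by
  set u : ℝ → ℂ := Set.indicator (Set.Ioc 0 1) (fun _ => 1 : ℝ → ℂ) with hu
  have key : ∀ s : ℂ, 0 < s.re → MellinConvergent (fun t => Real.log t • u t) s ∧
      HasDerivAt (mellin u) (mellin (fun t => Real.log t • u t) s) s := by
    intro s hs
    apply mellin_hasDerivAt_of_isBigO_rpow (a := s.re + 1) (b := 0) _ _ (by linarith) _ hs
    · apply MeasureTheory.Integrable.locallyIntegrable _ |>.locallyIntegrableOn
      rw [MeasureTheory.integrable_indicator_iff measurableSet_Ioc]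
      simp
    · refine (EventuallyEq.trans_isBigO (f₂ := fun _ => (0:ℂ)) ?_ ?_)
      · filter_upwards [eventually_gt_atTop 1] with t ht
        simp [hu, not_le.2 ht]
      · exact Asymptotics.isBigO_zero _ _
    · simp only [neg_zero, Real.rpow_zero]
      refine Asymptotics.IsBigO.of_bound 1 (Eventually.of_forall fun t => ?_)
      simp only [hu, Set.indicator]
      split_ifs <;> simp
  have hmel : ∀ s : ℂ, 0 < s.re → mellin (fun t => Real.log t • u t) s = - (s ^ 2)⁻¹ := by
    intro s hs
    have h1 := (key s hs).2
    have hs0 : s ≠ 0 := by rintro rfl; simp at hs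
    have h2 : HasDerivAt (fun s : ℂ => s⁻¹) (-(s^2)⁻¹) s := hasDerivAt_inv hs0
    refine h1.unique (h2.congr_of_eventuallyEq ?_)
    filter_upwards [(isOpen_lt continuous_const Complex.continuous_re).mem_nhds hs] with z hz
    rw [(hasMellin_one_Ioc hz).2, one_div]
  set v : ℝ → ℂ := fun t => ((max 0 (-Real.log t) : ℝ) : ℂ) with hv
  have huv : ∀ t ∈ Set.Ioi (0:ℝ), Real.log t • u t = - v t := by
    intro t ht
    have ht : 0 < t := ht
    by_cases h1 : t ≤ 1
    · have := Real.log_nonpos ht.le h1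
      simp [hu, hv, h1, ht, this]
    · have := Real.log_nonneg (not_le.1 h1).le
      simp [hu, hv, h1, this]
  have hconv : ∀ s : ℂ, 0 < s.re → MellinConvergent v s := by
    intro s hs
    have := (key s hs).1
    unfold MellinConvergent at this ⊢
    refine this.neg.congr_fun (fun t ht => ?_) measurableSet_Ioi
    simp only [Pi.neg_apply, huv t ht, smul_neg, neg_neg]
  have hmv : ∀ s : ℂ, 0 < s.re → mellin v s = (s ^ 2)⁻¹ := by
    intro s hs
    have := hmel s hs
    unfold mellin at this ⊢
    rw [← neg_eq_iff_eq_neg, ← MeasureTheory.integral_neg] at this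
    rw [← this]
    refine MeasureTheory.setIntegral_congr_fun measurableSet_Ioi (fun t ht => ?_)
    simp only [huv t ht, smul_neg, neg_neg]
  have hinv := mellinInv_mellin_eq c v (Real.exp_pos (-y)) (hconv c (by simpa)) (by
    unfold Complex.VerticalIntegrable
    have := integrable_line c hc (fun _ => 1) continuous_const 1 (by simp)
    refine this.congr (Eventually.of_forall fun t => ?_)
    simp only
    rw [hmv _ (by simpa), one_div]) (by
      have := Real.continuousAt_log (Real.exp_pos (-y)).ne'
      simp only [hv]
      fun_prop)
  unfold mellinInv at hinv
  simp only [hv, Real.log_exp, neg_neg] at hinv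
  have hpi : (Real.pi : ℂ) ≠ 0 := by exact_mod_cast Real.pi_ne_zero
  rw [← hinv, Complex.real_smul]
  push_cast
  rw [← mul_assoc, mul_one_div_cancel (by simp [hpi]), one_mul]
  congr 1
  ext t
  have := hmv (c + t * Complex.I) (by simpa)
  simp only [hv] at this
  rw [this, smul_eq_mul, div_eq_mul_inv]
  congr 1
  rw [← Complex.ofReal_neg, ← Complex.ofReal_exp, Complex.cpow_def_of_ne_zero (by simp), ← Complex.ofReal_log (Real.exp_pos _).le, Real.log_exp]
  congr 1
  push_cast; ring

theorem perron_zero (c : ℝ) (hc : 0 < c) (G : ℂ → ℂ) (hG : DifferentiableOn ℂ G {w | 0 < w.re}) (B : ℝ)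
    (hB : ∀ w : ℂ, 0 < w.re → ‖G w‖ ≤ B) :
    ∫ t : ℝ, G ((c : ℂ) + t * Complex.I) / ((c : ℂ) + t * Complex.I) ^ 2 = 0 := by
  have hB0 : 0 ≤ B := (norm_nonneg _).trans (hB 1 (by simp))
  have hcont : Continuous fun t : ℝ => G ((c : ℂ) + t * Complex.I) := by
    apply hG.continuousOn.comp_continuous (by fun_prop)
    intro t; simpa
  have hint := integrable_line c hc (fun t => G (c + t * Complex.I)) hcont B (fun t => hB _ (by simpa))
  have hlim := MeasureTheory.intervalIntegral_tendsto_integral hint tendsto_neg_atTop_atBot tendsto_id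
  refine tendsto_nhds_unique hlim ?_
  set g : ℂ → ℂ := fun w => G w / w ^ 2 with hg
  have hgb : ∀ w : ℂ, 0 < w.re → ∀ R : ℝ, 0 < R → R ≤ ‖w‖ → ‖g w‖ ≤ B / R ^ 2 := by
    intro w hw R hR hwR
    simp only [hg, norm_div, norm_pow]
    have := hB w hw
    gcongr
  apply squeeze_zero_norm' (a := fun R : ℝ => 4 * B / R)
  · filter_upwards [eventually_gt_atTop 0] with R hR
    have hrect := Complex.integral_boundary_rect_eq_zero_of_differentiableOn g (c + (-R : ℝ) * Complex.I)
      ((c + R : ℝ) + R * Complex.I) (by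
      apply DifferentiableOn.div
      · apply hG.mono
        intro w hw
        have := hw.1
        have h3 : c ≤ c + R := by linarith
        simp [Set.uIcc_of_le h3] at this
        show 0 < w.re
        linarith
      · fun_prop
      · intro w hw
        have := hw.1
        have h3 : c ≤ c + R := by linarith
        simp [Set.uIcc_of_le h3] at this
        have h0 : w ≠ 0 := by rintro rfl; simp at this; linarith
        exact pow_ne_zero _ h0)
    simp only [Complex.add_re, Complex.ofReal_re, Complex.mul_re, Complex.I_re, mul_zero, Complex.ofReal_im, Complex.I_im,
      add_zero, Complex.add_im, Complex.mul_im, mul_one, zero_add, smul_eq_mul, sub_self] at hrect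
    have hi1 : ‖∫ x : ℝ in c..(c+R), g (x + (-R : ℝ) * Complex.I)‖ ≤ B / R ^ 2 * |c + R - c| := by
      apply intervalIntegral.norm_integral_le_of_norm_le_const
      intro x hx
      rw [Set.uIoc_of_le (by linarith)] at hx
      apply hgb _ (by simp; linarith [hx.1]) _ hR
      refine le_trans ?_ (Complex.abs_im_le_norm _)
      simp [abs_of_pos hR]
    have hi2 : ‖∫ x : ℝ in c..(c+R), g (x + R * Complex.I)‖ ≤ B / R ^ 2 * |c + R - c| := by
      apply intervalIntegral.norm_integral_le_of_norm_le_const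
      intro x hx
      rw [Set.uIoc_of_le (by linarith)] at hx
      apply hgb _ (by simp; linarith [hx.1]) _ hR
      refine le_trans ?_ (Complex.abs_im_le_norm _)
      simp [abs_of_pos hR]
    have hi3 : ‖∫ x : ℝ in (-R)..R, g ((c + R : ℝ) + x * Complex.I)‖ ≤ B / R ^ 2 * |R - -R| := by
      apply intervalIntegral.norm_integral_le_of_norm_le_const
      intro x hx
      apply hgb _ (by simp; linarith) _ hR
      refine le_trans ?_ (Complex.abs_re_le_norm _)
      simp [abs_of_pos (add_pos hc hR)]
      linarith
    have e1 : |c + R - c| = R := by rw [add_sub_cancel_left, abs_of_pos hR]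
    have e2 : |R - -R| = 2 * R := by rw [abs_of_pos] <;> linarith
    rw [e1] at hi1 hi2
    rw [e2] at hi3
    have : ‖Complex.I * ∫ x : ℝ in (-R)..R, g (c + x * Complex.I)‖ ≤ 4 * B / R := by
      rw [← sub_eq_zero.1 hrect]
      calc _ ≤ _ := norm_add_le _ _
        _ ≤ _ := add_le_add_left (norm_sub_le _ _) _
        _ ≤ B / R ^ 2 * R + B / R ^ 2 * R + B / R ^ 2 * (2 * R) := by
          rw [norm_mul Complex.I, Complex.norm_I, one_mul]
          linarith
        _ = _ := by field_simp; ring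
    rw [norm_mul, Complex.norm_I, one_mul] at this
    exact this
  · exact tendsto_const_nhds.div_atTop tendsto_id

theorem real_bound (l : ℕ → ℝ) (hmono : StrictMono l) (a : ℕ → ℂ) (F : ℂ → ℂ) (x0 : ℝ)
    (hconv : ∀ x : ℝ, x0 < x → Tendsto (fun N : ℕ => ∑ n ∈ Finset.range N,
      a n * Complex.exp (-(l n : ℂ) * x)) atTop (nhds (F x))) (K : ℕ) :
    ∃ x1 B : ℝ, ∀ x : ℝ, x1 ≤ x →
      ‖F x - ∑ n ∈ Finset.range K, a n * Complex.exp (-(l n : ℂ) * x)‖ ≤ B * Real.exp (-(l K) * x) := by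
  set x1 := x0 + 1
  obtain ⟨B0, hB0⟩ := (hconv x1 (by simp [x1])).norm.bddAbove_range
  have hB0' : ∀ N, ‖∑ n ∈ Finset.range N, a n * Complex.exp (-(l n : ℂ) * x1)‖ ≤ B0 :=
    fun N => hB0 ⟨N, rfl⟩
  refine ⟨x1, 2 * B0 * Real.exp (l K * x1), fun x hx => ?_⟩
  have hab := abel_bound (fun k => a (K + k) * Complex.exp (-(l (K + k) : ℂ) * x1))
    (fun k => Real.exp (-(l (K + k)) * (x - x1))) (by
      intro i j hij
      apply Real.exp_le_exp.2
      have := hmono.monotone (Nat.add_le_add_left hij K)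
      nlinarith) (fun _ => (Real.exp_pos _).le) (2 * B0) (by
      intro n
      have h := Finset.sum_range_add (fun k => a k * Complex.exp (-(l k : ℂ) * x1)) K n
      rw [← sub_eq_iff_eq_add'] at h
      rw [← h]
      calc _ ≤ _ := norm_sub_le _ _
        _ ≤ _ := by linarith [hB0' (K + n), hB0' K])
  have hlim : Tendsto (fun N => ‖∑ n ∈ Finset.range (K + N), a n * Complex.exp (-(l n : ℂ) * x)
      - ∑ n ∈ Finset.range K, a n * Complex.exp (-(l n : ℂ) * x)‖) atTop
      (nhds ‖F x - ∑ n ∈ Finset.range K, a n * Complex.exp (-(l n : ℂ) * x)‖) := by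
    have h1 := hconv x (by simp only [x1] at hx; linarith)
    have h2 := h1.comp (tendsto_add_atTop_nat K)
    refine (Tendsto.sub_const ?_ _).norm
    refine h2.congr fun N => ?_
    simp only [Function.comp, add_comm]
  refine le_of_tendsto hlim (Eventually.of_forall fun N => ?_)
  rw [Finset.sum_range_add, add_sub_cancel_left]
  refine le_trans (le_of_eq ?_) ((hab N).trans (le_of_eq ?_))
  · congr 1
    refine Finset.sum_congr rfl fun k _ => ?_
    rw [Complex.ofReal_exp, mul_left_comm, ← Complex.exp_add]
    congr 2
    push_cast; ring
  · rw [add_zero, mul_assoc (2 * B0), ← Real.exp_add]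
    congr 2
    ring

theorem G_bound (l : ℕ → ℝ) (hmono : StrictMono l) (hnonneg : ∀ n, 0 ≤ l n)
    (a : ℕ → ℂ) (F : ℂ → ℂ) (η : ℝ) (hη : 0 < η)
    (hF : DifferentiableOn ℂ F {w | -η < w.re}) (M : ℝ) (hM : ∀ w : ℂ, -η < w.re → ‖F w‖ ≤ M)
    (x0 : ℝ)
    (hconv : ∀ x : ℝ, x0 < x → Tendsto (fun N : ℕ => ∑ n ∈ Finset.range N,
      a n * Complex.exp (-(l n : ℂ) * x)) atTop (nhds (F x)))
    (K : ℕ) (y : ℝ) (hy : y ≤ l K) :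
    ∃ B : ℝ, ∀ w : ℂ, 0 < w.re →
      ‖(F w - ∑ n ∈ Finset.range K, a n * Complex.exp (-(l n : ℂ) * w)) * Complex.exp (y * w)‖ ≤ B := by
  have hg : ∀ w : ℂ, 0 ≤ w.re →
      ‖F w - ∑ n ∈ Finset.range K, a n * Complex.exp (-(l n : ℂ) * w)‖
        ≤ M + ∑ n ∈ Finset.range K, ‖a n‖ := by
    intro w hw
    refine (norm_sub_le _ _).trans (add_le_add (hM w (by linarith)) ?_)
    refine norm_sum_le_of_le _ fun n _ => ?_
    rw [norm_mul, Complex.norm_exp]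
    apply mul_le_of_le_one_right (norm_nonneg _)
    rw [Real.exp_le_one_iff]
    have := mul_nonneg (hnonneg n) hw
    simp; linarith
  obtain ⟨x1, B, hB⟩ := real_bound l hmono a F x0 hconv K
  refine ⟨M + ∑ n ∈ Finset.range K, ‖a n‖, fun w hw => ?_⟩
  refine PhragmenLindelof.right_half_plane_of_bounded_on_real (f := fun w => (F w - ∑ n ∈ Finset.range K, a n * Complex.exp (-(l n : ℂ) * w)) * Complex.exp (y * w)) ?_ ?_ ?_ ?_ hw.le
  · apply DifferentiableOn.diffContOnCl
    rw [Complex.closure_setOfPred_lt_re]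
    refine DifferentiableOn.mul (DifferentiableOn.sub (hF.mono ?_) ?_) ?_
    · intro w hw
      have : 0 ≤ w.re := hw
      show -η < w.re
      linarith
    · exact Differentiable.differentiableOn (by fun_prop)
    · exact Differentiable.differentiableOn (by fun_prop)
  · refine ⟨1, by norm_num, |y|, ?_⟩
    refine Asymptotics.IsBigO.of_bound (M + ∑ n ∈ Finset.range K, ‖a n‖) ?_
    rw [eventually_inf_principal]
    refine Eventually.of_forall fun w hw => ?_
    have hw : 0 < w.re := hw
    rw [norm_mul]
    have h1 := hg w hw.le
    have h2 : ‖Complex.exp (y * w)‖ ≤ ‖Real.exp (|y| * ‖w‖ ^ (1:ℝ))‖ := by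
      rw [Complex.norm_exp, Real.norm_of_nonneg (Real.exp_pos _).le, Real.rpow_one]
      apply Real.exp_le_exp.2
      have := Complex.re_le_norm (y * w)
      simpa using this
    exact mul_le_mul h1 h2 (norm_nonneg _) ((norm_nonneg _).trans h1)
  · refine ⟨B, ?_⟩
    rw [eventually_map]
    filter_upwards [eventually_ge_atTop x1, eventually_ge_atTop 0] with x hx hx0
    rw [norm_mul]
    have h2 : ‖Complex.exp (y * x)‖ ≤ Real.exp (l K * x) := by
      rw [Complex.norm_exp]
      apply Real.exp_le_exp.2
      simp
      exact mul_le_mul_of_nonneg_right hy hx0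
    calc _ ≤ B * Real.exp (-(l K) * x) * Real.exp (l K * x) :=
          mul_le_mul (hB x hx) h2 (norm_nonneg _) ((norm_nonneg _).trans (hB x hx))
      _ = B := by rw [mul_assoc, ← Real.exp_add]; simp
  · intro t
    rw [norm_mul, Complex.norm_exp]
    simpa using hg (t * Complex.I) (by simp)

theorem perron_formula (l : ℕ → ℝ) (hmono : StrictMono l) (hnonneg : ∀ n, 0 ≤ l n)
    (a : ℕ → ℂ) (F : ℂ → ℂ) (η : ℝ) (hη : 0 < η)
    (hF : DifferentiableOn ℂ F {w | -η < w.re}) (M : ℝ) (hM : ∀ w : ℂ, -η < w.re → ‖F w‖ ≤ M)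
    (x0 : ℝ)
    (hconv : ∀ x : ℝ, x0 < x → Tendsto (fun N : ℕ => ∑ n ∈ Finset.range N,
      a n * Complex.exp (-(l n : ℂ) * x)) atTop (nhds (F x)))
    (K : ℕ) (y : ℝ) (hy : y ≤ l K) (c : ℝ) (hc : 0 < c) :
    MeasureTheory.Integrable (fun t : ℝ => F ((c : ℂ) + t * Complex.I) *
      (Complex.exp (y * ((c : ℂ) + t * Complex.I)) / ((c : ℂ) + t * Complex.I) ^ 2)) ∧
    ∫ t : ℝ, F ((c : ℂ) + t * Complex.I) *
      (Complex.exp (y * ((c : ℂ) + t * Complex.I)) / ((c : ℂ) + t * Complex.I) ^ 2)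
      = 2 * Real.pi * ∑ k ∈ Finset.range K, a k * ((max 0 (y - l k) : ℝ) : ℂ) := by
  obtain ⟨B, hB⟩ := G_bound l hmono hnonneg a F η hη hF M hM x0 hconv K y hy
  set G : ℂ → ℂ := fun w => (F w - ∑ n ∈ Finset.range K, a n * Complex.exp (-(l n : ℂ) * w)) * Complex.exp (y * w) with hGdef
  have hF0 : DifferentiableOn ℂ F {w | 0 < w.re} := hF.mono (fun w hw => by
    have : 0 < w.re := hw
    show -η < w.re
    linarith)
  have hG : DifferentiableOn ℂ G {w | 0 < w.re} := by
    refine DifferentiableOn.mul (DifferentiableOn.sub hF0 ?_) ?_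
    · exact Differentiable.differentiableOn (by fun_prop)
    · exact Differentiable.differentiableOn (by fun_prop)
  have hz := perron_zero c hc G hG B hB
  have hGc : Continuous fun t : ℝ => G ((c : ℂ) + t * Complex.I) := by
    apply hG.continuousOn.comp_continuous (by fun_prop)
    intro t; simpa
  have hGi := integrable_line c hc (fun t => G (c + t * Complex.I)) hGc B (fun t => hB _ (by simpa))
  have hei : ∀ k ∈ Finset.range K, MeasureTheory.Integrable (fun t : ℝ => a k * (Complex.exp ((y - l k : ℝ) * ((c : ℂ) + t * Complex.I)) / ((c : ℂ) + t * Complex.I) ^ 2)) := by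
    intro k _
    refine (integrable_line c hc (fun t => Complex.exp ((y - l k : ℝ) * ((c : ℂ) + t * Complex.I))) (by fun_prop) (Real.exp ((y - l k) * c)) ?_).const_mul _
    intro t
    rw [Complex.norm_exp]
    simp
  have heq : (fun t : ℝ => F ((c : ℂ) + t * Complex.I) *
      (Complex.exp (y * ((c : ℂ) + t * Complex.I)) / ((c : ℂ) + t * Complex.I) ^ 2))
      = fun t : ℝ => G (c + t * Complex.I) / ((c : ℂ) + t * Complex.I) ^ 2 +
        ∑ k ∈ Finset.range K, a k * (Complex.exp ((y - l k : ℝ) * ((c : ℂ) + t * Complex.I)) / ((c : ℂ) + t * Complex.I) ^ 2) := by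
    ext t
    set w : ℂ := (c : ℂ) + t * Complex.I
    have : ∀ k, a k * (Complex.exp ((y - l k : ℝ) * w) / w ^ 2) = a k * Complex.exp (-(l k : ℂ) * w) * (Complex.exp (y * w) / w ^ 2) := by
      intro k
      have : ((y - l k : ℝ) : ℂ) * w = -(l k : ℂ) * w + y * w := by push_cast; ring
      rw [this, Complex.exp_add]
      ring
    simp_rw [this]
    rw [← Finset.sum_mul]
    simp only [hGdef]
    ring
  rw [heq]
  have hsum := MeasureTheory.integrable_finsetSum (Finset.range K) hei
  refine ⟨hGi.add hsum, ?_⟩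
  rw [MeasureTheory.integral_add hGi hsum, hz, zero_add, MeasureTheory.integral_finsetSum _ hei, Finset.mul_sum]
  refine Finset.sum_congr rfl fun k _ => ?_
  rw [MeasureTheory.integral_const_mul, perron_basic c hc]
  ring

theorem integral_inv_sq_add (c : ℝ) (hc : 0 < c) :
    ∫ t : ℝ, (c ^ 2 + t ^ 2)⁻¹ = Real.pi / c := by
  have h : ∀ t : ℝ, (c ^ 2 + t ^ 2)⁻¹ = (c ^ 2)⁻¹ * (1 + (t / c) ^ 2)⁻¹ := by
    intro t
    rw [← mul_inv]
    congr 1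
    field_simp
  simp_rw [h]
  rw [MeasureTheory.integral_const_mul, MeasureTheory.Measure.integral_comp_div (fun t : ℝ => (1 + t ^ 2)⁻¹),
    integral_univ_inv_one_add_sq, abs_of_pos hc, smul_eq_mul]
  field_simp

theorem exp_sub_one_bound1 (z : ℂ) (hz : 0 ≤ z.re) : ‖Complex.exp z - 1‖ ≤ Real.exp z.re * ‖z‖ := by
  have := Convex.norm_image_sub_le_of_norm_deriv_le (𝕜 := ℂ) (f := Complex.exp) (s := {w : ℂ | w.re ≤ z.re})
    (x := 0) (y := z) (C := Real.exp z.re) (fun x _ => Complex.differentiableAt_exp)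
    (fun x hx => by
      rw [Complex.deriv_exp, Complex.norm_exp]
      exact Real.exp_le_exp.2 hx) (convex_halfSpace_re_le _) (by simpa using hz) (by simp)
  simpa using this

theorem exp_sub_one_bound2 (z : ℂ) (hz : 0 ≤ z.re) : ‖Complex.exp z - 1‖ ≤ 2 * Real.exp z.re := by
  have h := norm_sub_le (Complex.exp z) 1
  rw [Complex.norm_exp, norm_one] at h
  have := Real.one_le_exp hz
  linarith

theorem trap_integral (c d : ℝ) (hc : 0 < c) (hd : 0 < d) (hcd : c ≤ 1 / d) :
    MeasureTheory.Integrable (fun t : ℝ => min (d / √(c ^ 2 + t ^ 2)) (2 / (c ^ 2 + t ^ 2))) ∧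
    ∫ t : ℝ, min (d / √(c ^ 2 + t ^ 2)) (2 / (c ^ 2 + t ^ 2)) ≤ 2 * d * (3 + Real.log (1 / d / c)) := by
  set m : ℝ → ℝ := fun t => min (d / √(c ^ 2 + t ^ 2)) (2 / (c ^ 2 + t ^ 2)) with hm
  have hpos : ∀ t : ℝ, 0 < c ^ 2 + t ^ 2 := fun t => by positivity
  have hm0 : ∀ t, 0 ≤ m t := fun t => le_min (by positivity) (by positivity)
  have hmc : Continuous m := by
    apply Continuous.min
    · apply continuous_const.div (by fun_prop)
      intro t; exact (Real.sqrt_pos.2 (hpos t)).ne'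
    · apply continuous_const.div (by fun_prop)
      intro t; exact (hpos t).ne'
  have hmi : MeasureTheory.Integrable m := by
    refine ((integrable_inv_sq_add c hc).const_mul 2).mono' hmc.aestronglyMeasurable (Eventually.of_forall fun t => ?_)
    rw [Real.norm_of_nonneg (hm0 t), ← div_eq_mul_inv]
    exact min_le_right _ _
  refine ⟨hmi, ?_⟩
  have h1 : ∫ t : ℝ, m t = 2 * ∫ t in Set.Ioi (0:ℝ), m t := by
    rw [← integral_comp_abs]
    simp [hm]
  have hd' : 0 < 1 / d := by positivity
  have hA : ∫ t in Set.Ioc 0 c, m t ≤ d := by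
    rw [← intervalIntegral.integral_of_le hc.le]
    have : ‖∫ t in (0:ℝ)..c, m t‖ ≤ d / c * |c - 0| := by
      apply intervalIntegral.norm_integral_le_of_norm_le_const
      intro t _
      rw [Real.norm_of_nonneg (hm0 t)]
      refine (min_le_left _ _).trans ?_
      have : c ≤ √(c ^ 2 + t ^ 2) := Real.le_sqrt_of_sq_le (by nlinarith [sq_nonneg t])
      gcongr
    rw [sub_zero, abs_of_pos hc, div_mul_cancel₀ _ hc.ne'] at this
    exact (le_abs_self _).trans this
  have hB : ∫ t in Set.Ioc c (1/d), m t ≤ d * Real.log (1 / d / c) := by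
    rw [← intervalIntegral.integral_of_le hcd, ← integral_inv_of_pos hc hd', ← intervalIntegral.integral_const_mul]
    apply intervalIntegral.integral_mono_on hcd hmi.intervalIntegrable
    · apply IntervalIntegrable.const_mul
      apply intervalIntegral.intervalIntegrable_inv (f := fun x => x) _ (by fun_prop)
      intro x hx
      rw [Set.uIcc_of_le hcd] at hx
      exact (hc.trans_le hx.1).ne'
    · intro t ht
      have ht0 : 0 < t := hc.trans_le ht.1
      refine (min_le_left _ _).trans ?_
      rw [← div_eq_mul_inv]
      have : t ≤ √(c ^ 2 + t ^ 2) := Real.le_sqrt_of_sq_le (by nlinarith [sq_nonneg c])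
      gcongr
  have hC : ∫ t in Set.Ioi (1/d), m t ≤ 2 * d := by
    have hi := integrableOn_Ioi_rpow_of_lt (a := -2) (by norm_num) hd'
    have := integral_Ioi_rpow_of_lt (a := -2) (by norm_num) hd'
    have e : 2 * d = ∫ t in Set.Ioi (1/d), 2 * t ^ (-2 : ℝ) := by
      rw [MeasureTheory.integral_const_mul, this]
      norm_num
      rw [Real.rpow_neg_one, inv_inv]
    rw [e]
    apply MeasureTheory.setIntegral_mono_on hmi.integrableOn (hi.const_mul 2) measurableSet_Ioi
    intro t ht
    have ht0 : 0 < t := hd'.trans ht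
    refine (min_le_right _ _).trans ?_
    rw [Real.rpow_neg ht0.le, ← div_eq_mul_inv, Real.rpow_two]
    gcongr
    nlinarith [sq_nonneg c]
  rw [h1, ← Set.Ioc_union_Ioi_eq_Ioi hc.le, MeasureTheory.setIntegral_union (Set.Ioc_disjoint_Ioi le_rfl) measurableSet_Ioi hmi.integrableOn hmi.integrableOn,
    ← Set.Ioc_union_Ioi_eq_Ioi hcd, MeasureTheory.setIntegral_union (Set.Ioc_disjoint_Ioi le_rfl) measurableSet_Ioi hmi.integrableOn hmi.integrableOn]
  linarith

/-- second difference kernel bound -/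
theorem coef_bound (l : ℕ → ℝ) (hmono : StrictMono l) (hnonneg : ∀ n, 0 ≤ l n)
    (a : ℕ → ℂ) (F : ℂ → ℂ) (η : ℝ) (hη : 0 < η)
    (hF : DifferentiableOn ℂ F {w | -η < w.re}) (M : ℝ) (hM : ∀ w : ℂ, -η < w.re → ‖F w‖ ≤ M)
    (x0 : ℝ)
    (hconv : ∀ x : ℝ, x0 < x → Tendsto (fun N : ℕ => ∑ n ∈ Finset.range N,
      a n * Complex.exp (-(l n : ℂ) * x)) atTop (nhds (F x)))
    (k : ℕ) : ‖a k‖ ≤ 2 * Real.exp 1 * M := by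
  obtain ⟨d, hd, hd1, hd2⟩ : ∃ d > 0, l k + d ≤ l (k+1) ∧ ∀ j < k, l j ≤ l k - d := by
    rcases Nat.eq_zero_or_pos k with rfl | hk
    · exact ⟨l 1 - l 0, sub_pos.2 (hmono (by norm_num)), by simp, by simp⟩
    · refine ⟨min (l (k+1) - l k) (l k - l (k-1)), lt_min (sub_pos.2 (hmono (by omega))) (sub_pos.2 (hmono (by omega))), ?_, ?_⟩
      · linarith [min_le_left (l (k+1) - l k) (l k - l (k-1))]
      · intro j hj
        have := hmono.monotone (show j ≤ k - 1 by omega)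
        linarith [min_le_right (l (k+1) - l k) (l k - l (k-1))]
  have hlk := hnonneg k
  set c : ℝ := 1 / (l k + d) with hcdef
  have hc : 0 < c := by positivity
  have hM0 : 0 ≤ M := (norm_nonneg _).trans (hM 1 (by simp; linarith))
  obtain ⟨i1, e1⟩ := perron_formula l hmono hnonneg a F η hη hF M hM x0 hconv (k+1) (l k + d) hd1 c hc
  obtain ⟨i2, e2⟩ := perron_formula l hmono hnonneg a F η hη hF M hM x0 hconv (k+1) (l k) (by linarith) c hc
  obtain ⟨i3, e3⟩ := perron_formula l hmono hnonneg a F η hη hF M hM x0 hconv (k+1) (l k - d) (by linarith) c hc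
  have hcomb : ∫ t : ℝ, F ((c : ℂ) + t * Complex.I) * (Complex.exp ((l k - d : ℝ) * ((c : ℂ) + t * Complex.I)) *
      (Complex.exp (d * ((c : ℂ) + t * Complex.I)) - 1) ^ 2 / ((c : ℂ) + t * Complex.I) ^ 2)
      = 2 * Real.pi * (a k * d) := by
    have hs : (2 * Real.pi * (a k * d) : ℂ) = 2 * Real.pi * ∑ j ∈ Finset.range (k+1), a j * ((max 0 (l k + d - l j) : ℝ) : ℂ)
        - 2 * (2 * Real.pi * ∑ j ∈ Finset.range (k+1), a j * ((max 0 (l k - l j) : ℝ) : ℂ))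
        + 2 * Real.pi * ∑ j ∈ Finset.range (k+1), a j * ((max 0 (l k - d - l j) : ℝ) : ℂ) := by
      have hz : ∑ j ∈ Finset.range (k+1), (a j * ((max 0 (l k + d - l j) : ℝ) : ℂ) - 2 * (a j * ((max 0 (l k - l j) : ℝ) : ℂ))
          + a j * ((max 0 (l k - d - l j) : ℝ) : ℂ)) = a k * d := by
        rw [Finset.sum_range_succ, Finset.sum_eq_zero, zero_add]
        · rw [max_eq_right (by linarith), max_eq_left (by linarith), max_eq_left (by linarith)]
          push_cast; ring
        · intro j hj
          have := hd2 j (Finset.mem_range.1 hj)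
          rw [max_eq_right (by linarith), max_eq_right (by linarith), max_eq_right (by linarith)]
          push_cast; ring
      rw [← hz, Finset.sum_add_distrib, Finset.sum_sub_distrib, ← Finset.mul_sum]
      ring
    rw [hs, ← e1, ← e2, ← e3, ← MeasureTheory.integral_const_mul, ← MeasureTheory.integral_sub i1 (i2.const_mul 2)]
    refine Eq.trans ?_ (MeasureTheory.integral_add (i1.sub (i2.const_mul 2)) i3)
    congr 1
    ext t
    set w : ℂ := (c : ℂ) + t * Complex.I
    have x1 : Complex.exp ((l k + d : ℝ) * w) = Complex.exp ((l k - d : ℝ) * w) * Complex.exp (d * w) ^ 2 := by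
      rw [← Complex.exp_nat_mul, ← Complex.exp_add]; congr 1; push_cast; ring
    have x2 : Complex.exp ((l k : ℝ) * w) = Complex.exp ((l k - d : ℝ) * w) * Complex.exp (d * w) := by
      rw [← Complex.exp_add]; congr 1; push_cast; ring
    show _ = F w * _ - 2 * (F w * _) + F w * _
    rw [x1, x2]
    ring
  have hbd : ‖∫ t : ℝ, F ((c : ℂ) + t * Complex.I) * (Complex.exp ((l k - d : ℝ) * ((c : ℂ) + t * Complex.I)) *
      (Complex.exp (d * ((c : ℂ) + t * Complex.I)) - 1) ^ 2 / ((c : ℂ) + t * Complex.I) ^ 2)‖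
      ≤ ∫ t : ℝ, M * Real.exp 1 * 8 * ((2 / d) ^ 2 + t ^ 2)⁻¹ := by
    apply MeasureTheory.norm_integral_le_of_norm_le
    · exact (integrable_inv_sq_add _ (by positivity)).const_mul _
    · refine Eventually.of_forall fun t => ?_
      have hline := norm_line c t
      have hre : ((c : ℂ) + t * Complex.I).re = c := by simp
      have hw0 := line_ne c t hc
      set w : ℂ := (c : ℂ) + t * Complex.I
      have hdw : ((d : ℂ) * w).re = d * c := by simp [hre]
      have b1 := exp_sub_one_bound1 (d * w) (by rw [hdw]; positivity)
      have b2 := exp_sub_one_bound2 (d * w) (by rw [hdw]; positivity)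
      rw [hdw] at b1 b2
      rw [norm_mul, Complex.norm_real, Real.norm_of_nonneg hd.le] at b1
      rw [norm_mul, norm_div, norm_mul, norm_pow, norm_pow, Complex.norm_exp]
      have hre2 : (((l k - d : ℝ) : ℂ) * w).re = (l k - d) * c := by simp [hre]
      rw [hre2]
      have hwn : 0 < ‖w‖ := norm_pos_iff.2 hw0
      have hE : Real.exp ((l k - d) * c) * Real.exp (d * c) ^ 2 = Real.exp 1 := by
        rw [← Real.exp_nat_mul, ← Real.exp_add]; congr 1
        have : (l k + d) * c = 1 := by rw [hcdef]; field_simp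
        push_cast; linarith
      set X := ‖Complex.exp (d * w) - 1‖ / Real.exp (d * c) with hX
      have hX0 : 0 ≤ X := by positivity
      have hXe : ‖Complex.exp (d * w) - 1‖ = X * Real.exp (d * c) := by rw [hX]; field_simp
      have c1 : X ≤ d * ‖w‖ := by rw [hX, div_le_iff₀ (Real.exp_pos _)]; linarith
      have c2 : X ≤ 2 := by rw [hX, div_le_iff₀ (Real.exp_pos _)]; linarith
      have key : X ^ 2 / ‖w‖ ^ 2 ≤ 8 * ((2 / d) ^ 2 + t ^ 2)⁻¹ := by
        rw [← div_eq_mul_inv, div_le_div_iff₀ (by positivity) (by positivity)]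
        have s1 : X ^ 2 * (2 / d) ^ 2 ≤ 4 * ‖w‖ ^ 2 := by
          have : X * (2 / d) ≤ 2 * ‖w‖ := by
            calc X * (2 / d) ≤ d * ‖w‖ * (2 / d) := by gcongr
              _ = _ := by field_simp
          calc X ^ 2 * (2 / d) ^ 2 = (X * (2 / d)) ^ 2 := by ring
            _ ≤ (2 * ‖w‖) ^ 2 := by gcongr
            _ = _ := by ring
        have s2 : X ^ 2 * t ^ 2 ≤ 4 * ‖w‖ ^ 2 := by
          have : X ^ 2 ≤ 2 ^ 2 := by gcongr
          have : t ^ 2 ≤ ‖w‖ ^ 2 := by rw [hline]; nlinarith [sq_nonneg c]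
          nlinarith [sq_nonneg t, sq_nonneg X]
        linarith
      rw [hXe]
      calc ‖F w‖ * (Real.exp ((l k - d) * c) * (X * Real.exp (d * c)) ^ 2 / ‖w‖ ^ 2)
          = ‖F w‖ * ((Real.exp ((l k - d) * c) * Real.exp (d * c) ^ 2) * (X ^ 2 / ‖w‖ ^ 2)) := by ring
        _ ≤ M * (Real.exp 1 * (8 * ((2 / d) ^ 2 + t ^ 2)⁻¹)) := by
          rw [hE]
          have := hM w (by rw [hre]; linarith)
          gcongr
        _ = _ := by ring
  rw [hcomb, MeasureTheory.integral_const_mul, integral_inv_sq_add _ (by positivity)] at hbd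
  have hn : ‖(2 * Real.pi * (a k * d) : ℂ)‖ = 2 * Real.pi * d * ‖a k‖ := by
    simp [abs_of_pos Real.pi_pos, abs_of_pos hd]; ring
  rw [hn] at hbd
  have e : M * Real.exp 1 * 8 * (Real.pi / (2 / d)) = 2 * Real.pi * d * (2 * Real.exp 1 * M) := by
    field_simp; ring
  rw [e] at hbd
  exact le_of_mul_le_mul_left hbd (by positivity)

theorem partial_bound_s5 (l : ℕ → ℝ) (hmono : StrictMono l) (hnonneg : ∀ n, 0 ≤ l n)
    (a : ℕ → ℂ) (F : ℂ → ℂ) (η : ℝ) (hη : 0 < η)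
    (hF : DifferentiableOn ℂ F {w | -η < w.re}) (M : ℝ) (hM : ∀ w : ℂ, -η < w.re → ‖F w‖ ≤ M)
    (x0 : ℝ)
    (hconv : ∀ x : ℝ, x0 < x → Tendsto (fun N : ℕ => ∑ n ∈ Finset.range N,
      a n * Complex.exp (-(l n : ℂ) * x)) atTop (nhds (F x)))
    (n m : ℕ) (hnm : n < m) :
    ‖∑ k ∈ Finset.range (n+1), a k‖ ≤ 6 * Real.exp 1 * M *
      (Real.log ((l m + l n) / (l m - l n)) + ((m : ℝ) - (n : ℝ))) := by
  have hl : l n < l m := hmono hnm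
  have hln := hnonneg n
  set d : ℝ := l m - l n with hd_def
  have hd : 0 < d := sub_pos.2 hl
  have hlm : 0 < l m := by linarith
  set c : ℝ := 1 / l m with hcdef
  have hc : 0 < c := by positivity
  have hcd : c ≤ 1 / d := one_div_le_one_div_of_le hd (by linarith)
  have hM0 : 0 ≤ M := (norm_nonneg _).trans (hM 1 (by simp; linarith))
  obtain ⟨i1, e1⟩ := perron_formula l hmono hnonneg a F η hη hF M hM x0 hconv m (l m) le_rfl c hc
  obtain ⟨i2, e2⟩ := perron_formula l hmono hnonneg a F η hη hF M hM x0 hconv m (l n) hl.le c hc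
  obtain ⟨ti, tb⟩ := trap_integral c d hc hd hcd
  set T : ℂ := ∑ k ∈ Finset.Ico (n+1) m, a k * ((l m - l k : ℝ) : ℂ) with hT
  have hcomb : ∫ t : ℝ, F ((c : ℂ) + t * Complex.I) * (Complex.exp ((l n : ℝ) * ((c : ℂ) + t * Complex.I)) *
      (Complex.exp (d * ((c : ℂ) + t * Complex.I)) - 1) / ((c : ℂ) + t * Complex.I) ^ 2)
      = 2 * Real.pi * (d * ∑ k ∈ Finset.range (n+1), a k + T) := by
    have hz : ∑ j ∈ Finset.range m, (a j * ((max 0 (l m - l j) : ℝ) : ℂ) - a j * ((max 0 (l n - l j) : ℝ) : ℂ))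
        = d * ∑ k ∈ Finset.range (n+1), a k + T := by
      rw [← Finset.sum_range_add_sum_Ico _ (show n + 1 ≤ m from hnm), Finset.mul_sum]
      congr 1
      · refine Finset.sum_congr rfl fun j hj => ?_
        have h1 : l j ≤ l n := hmono.monotone (Nat.lt_succ_iff.1 (Finset.mem_range.1 hj))
        rw [max_eq_right (by linarith), max_eq_right (by linarith), hd_def]
        push_cast; ring
      · refine Finset.sum_congr rfl fun j hj => ?_
        rw [Finset.mem_Ico] at hj
        have h1 : l n ≤ l j := hmono.monotone (by omega)
        have h2 : l j ≤ l m := hmono.monotone (by omega)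
        rw [max_eq_right (by linarith), max_eq_left (by linarith)]
        push_cast; ring
    rw [← hz, Finset.sum_sub_distrib, mul_sub, ← e1, ← e2, ← MeasureTheory.integral_sub i1 i2]
    congr 1
    ext t
    set w : ℂ := (c : ℂ) + t * Complex.I
    have x2 : Complex.exp ((l m : ℝ) * w) = Complex.exp ((l n : ℝ) * w) * Complex.exp (d * w) := by
      rw [← Complex.exp_add]; congr 1; rw [hd_def]; push_cast; ring
    rw [x2]
    ring
  have hbd : ‖∫ t : ℝ, F ((c : ℂ) + t * Complex.I) * (Complex.exp ((l n : ℝ) * ((c : ℂ) + t * Complex.I)) *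
      (Complex.exp (d * ((c : ℂ) + t * Complex.I)) - 1) / ((c : ℂ) + t * Complex.I) ^ 2)‖
      ≤ ∫ t : ℝ, M * Real.exp 1 * min (d / √(c ^ 2 + t ^ 2)) (2 / (c ^ 2 + t ^ 2)) := by
    apply MeasureTheory.norm_integral_le_of_norm_le (ti.const_mul _)
    refine Eventually.of_forall fun t => ?_
    have hline := norm_line c t
    have hre : ((c : ℂ) + t * Complex.I).re = c := by simp
    have hw0 := line_ne c t hc
    set w : ℂ := (c : ℂ) + t * Complex.I
    have hdw : ((d : ℂ) * w).re = d * c := by simp [hre]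
    have b1 := exp_sub_one_bound1 (d * w) (by rw [hdw]; positivity)
    have b2 := exp_sub_one_bound2 (d * w) (by rw [hdw]; positivity)
    rw [hdw] at b1 b2
    rw [norm_mul, Complex.norm_real, Real.norm_of_nonneg hd.le] at b1
    rw [norm_mul, norm_div, norm_mul, norm_pow, Complex.norm_exp]
    have hre2 : (((l n : ℝ) : ℂ) * w).re = l n * c := by simp [hre]
    rw [hre2]
    have hwn : 0 < ‖w‖ := norm_pos_iff.2 hw0
    have hE : Real.exp (l n * c) * Real.exp (d * c) = Real.exp 1 := by
      rw [← Real.exp_add]; congr 1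
      have : l m * c = 1 := by rw [hcdef]; field_simp
      rw [hd_def]; linarith
    set X := ‖Complex.exp (d * w) - 1‖ / Real.exp (d * c) with hX
    have hX0 : 0 ≤ X := by positivity
    have hXe : ‖Complex.exp (d * w) - 1‖ = X * Real.exp (d * c) := by rw [hX]; field_simp
    have c1 : X ≤ d * ‖w‖ := by rw [hX, div_le_iff₀ (Real.exp_pos _)]; linarith
    have c2 : X ≤ 2 := by rw [hX, div_le_iff₀ (Real.exp_pos _)]; linarith
    rw [← hline, Real.sqrt_sq hwn.le]
    have key : X / ‖w‖ ^ 2 ≤ min (d / ‖w‖) (2 / ‖w‖ ^ 2) := by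
      apply le_min
      · rw [div_le_div_iff₀ (by positivity) (by positivity)]
        nlinarith
      · gcongr
    rw [hXe]
    calc ‖F w‖ * (Real.exp (l n * c) * (X * Real.exp (d * c)) / ‖w‖ ^ 2)
        = ‖F w‖ * ((Real.exp (l n * c) * Real.exp (d * c)) * (X / ‖w‖ ^ 2)) := by ring
      _ ≤ M * (Real.exp 1 * min (d / ‖w‖) (2 / ‖w‖ ^ 2)) := by
        rw [hE]
        have := hM w (by rw [hre]; linarith)
        gcongr
      _ = _ := by ring
  rw [hcomb, MeasureTheory.integral_const_mul] at hbd
  have hbd2 := hbd.trans (mul_le_mul_of_nonneg_left tb (by positivity))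
  have hTb : ‖T‖ ≤ d * ((m : ℝ) - n - 1) * (2 * Real.exp 1 * M) := by
    have : ‖T‖ ≤ ∑ k ∈ Finset.Ico (n+1) m, (2 * Real.exp 1 * M) * d := by
      refine norm_sum_le_of_le _ fun k hk => ?_
      rw [Finset.mem_Ico] at hk
      have h1 : l n ≤ l k := hmono.monotone (by omega)
      have h2 : l k ≤ l m := hmono.monotone (by omega)
      rw [norm_mul, Complex.norm_real, Real.norm_of_nonneg (by linarith)]
      have := coef_bound l hmono hnonneg a F η hη hF M hM x0 hconv k
      have h3 : l m - l k ≤ d := by rw [hd_def]; linarith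
      have h4 : 0 ≤ l m - l k := by linarith
      exact mul_le_mul this h3 h4 (by positivity)
    rw [Finset.sum_const, Nat.card_Ico, nsmul_eq_mul, Nat.cast_sub (show n + 1 ≤ m from hnm)] at this
    push_cast at this
    linarith
  set S : ℂ := ∑ k ∈ Finset.range (n+1), a k
  have hn : ‖(2 * Real.pi * (d * S + T) : ℂ)‖ = 2 * Real.pi * ‖d * S + T‖ := by
    simp [abs_of_pos Real.pi_pos]
  rw [hn] at hbd2
  have hlog : Real.log (1 / d / c) ≤ Real.log ((l m + l n) / d) := by
    apply Real.log_le_log (by positivity)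
    rw [hcdef]
    have : 1 / d / (1 / l m) = l m / d := by field_simp
    rw [this]
    gcongr
    linarith
  have hlog0 : 0 ≤ Real.log ((l m + l n) / d) := by
    apply Real.log_nonneg
    rw [le_div_iff₀ hd, hd_def]; linarith
  set Lg := Real.log ((l m + l n) / d)
  have hU : ‖d * S + T‖ ≤ M * Real.exp 1 * (d * (3 + Lg)) := by
    have hpi : 1 ≤ Real.pi := by linarith [Real.pi_gt_three]
    have h1 : 2 * ‖d * S + T‖ ≤ 2 * Real.pi * ‖d * S + T‖ := by
      nlinarith [norm_nonneg (d * S + T)]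
    have h2 : M * Real.exp 1 * (2 * d * (3 + Real.log (1 / d / c))) ≤ M * Real.exp 1 * (2 * d * (3 + Lg)) := by
      gcongr
    linarith
  have hdS : d * ‖S‖ ≤ ‖d * S + T‖ + ‖T‖ := by
    have := norm_sub_le (d * S + T) T
    rw [add_sub_cancel_right, norm_mul, Complex.norm_real, Real.norm_of_nonneg hd.le] at this
    exact this
  have hmn : (1:ℝ) ≤ (m:ℝ) - n := by
    have : ((n + 1 : ℕ) : ℝ) ≤ m := by exact_mod_cast hnm
    push_cast at this; linarith
  refine le_of_mul_le_mul_left (a := d) ?_ hd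
  calc d * ‖S‖ ≤ M * Real.exp 1 * (d * (3 + Lg)) + d * ((m : ℝ) - n - 1) * (2 * Real.exp 1 * M) := by linarith
    _ = (d * Real.exp 1 * M) * ((3 + Lg) + 2 * ((m : ℝ) - n - 1)) := by ring
    _ ≤ (d * Real.exp 1 * M) * (6 * (Lg + ((m : ℝ) - n))) := by
      gcongr
      linarith
    _ = _ := by ring

/-- A frequency satisfying (NC) satisfies Bohr's theorem: every somewhere-convergent
`λ`-Dirichlet series with a bounded holomorphic extension `f` to `[Re s > 0]` converges
uniformly to `f` on every half-plane `[Re s > ε]`, `ε > 0`. -/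
theorem bohr_theorem_under_NC (l : ℕ → ℝ) (hmono : StrictMono l) (hnonneg : ∀ n, 0 ≤ l n)
    (htend : Tendsto l atTop atTop)
    (hNC : ∀ δ > (0 : ℝ), ∃ C > (0 : ℝ), ∀ n : ℕ, ∃ m : ℕ, n < m ∧
      Real.log ((l m + l n) / (l m - l n)) + ((m : ℝ) - (n : ℝ)) ≤ C * Real.exp (δ * l n))
    (a : ℕ → ℂ) (σ₀ : ℝ) (f : ℂ → ℂ)
    (hconv : ∀ s : ℂ, σ₀ < s.re →
      Tendsto (fun N : ℕ => ∑ n ∈ Finset.range N, a n * Complex.exp (-(l n : ℂ) * s))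
        atTop (nhds (f s)))
    (hf : DifferentiableOn ℂ f {s : ℂ | 0 < s.re})
    (hbdd : ∃ M : ℝ, ∀ s : ℂ, 0 < s.re → ‖f s‖ ≤ M) :
    ∀ ε > (0 : ℝ),
      TendstoUniformlyOn
        (fun (N : ℕ) (s : ℂ) => ∑ n ∈ Finset.range N, a n * Complex.exp (-(l n : ℂ) * s))
        f atTop {s : ℂ | ε < s.re} := by
  intro ε hε
  obtain ⟨M, hM⟩ := hbdd
  have hM0 : 0 ≤ M := (norm_nonneg _).trans (hM 1 (by simp))
  obtain ⟨C, hC, hCm⟩ := hNC (ε / 2) (by positivity)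
  have := bohr_final l hmono htend a σ₀ f hconv hf (ε / 2) (by positivity) (6 * Real.exp 1 * M * C) (by positivity) (by
    intro s hs n
    obtain ⟨m, hnm, hle⟩ := hCm n
    have hpb := partial_bound_s5 l hmono hnonneg (fun k => a k * Complex.exp (-(l k : ℂ) * s)) (fun w => f (s + w)) s.re hs
      (by
        apply hf.comp (by fun_prop)
        intro w hw
        have : -s.re < w.re := hw
        show 0 < (s + w).re
        simp; linarith) M (by
        intro w hw
        apply hM
        simp; linarith) σ₀ (by
        intro x hx
        refine (hconv (s + x) (by simp; linarith)).congr fun N => ?_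
        refine Finset.sum_congr rfl fun k _ => ?_
        rw [mul_assoc, ← Complex.exp_add]
        congr 2; ring) n m hnm
    refine hpb.trans ?_
    rw [mul_assoc (6 * Real.exp 1 * M)]
    gcongr)
  rwa [mul_div_cancel₀ ε two_ne_zero] at this
end
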